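/- Let k, m ∈ ℕ and let α ∈ (k−1, k) be a non-integer real with α + m > 1/2. There exists a constant C > 0, depending only on α and m, such that for every integer p with α + m < p + 1 and every ω ∈ 𝒰^{α,m}_{−1+}((−1,1)), the Gauss–Radau projections satisfy |ω(−1) − (Π_p^− ω)(−1)| ≤ C · p^{−min{2α, α+m−1/2}} · U^{α,m}_{−1+}(ω;(−1,1)) and |ω(1) − (Π_p^+ ω)(1)| ≤ C · p^{−min{2α, α+m−1/2}} · U^{α,m}_{−1+}(ω;(−1,1)), where the pointwise values of ω at ±1 are those of its continuous representative on [−1,1]. -/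

import Mathlib

open MeasureTheory Set Filter

/-- The left Caputo fractional derivative of order `α ∈ (k−1,k)` based at `a`:
`(^C D^α_{a+} u)(x) = (1/Γ(k−α)) ∫_a^x (x−y)^{k−α−1} u^{(k)}(y) dy`. -/
noncomputable def caputoL (k : ℕ) (α a : ℝ) (u : ℝ → ℝ) (x : ℝ) : ℝ :=
  (1 / Real.Gamma ((k : ℝ) - α)) *
    ∫ y in a..x, (x - y) ^ ((k : ℝ) - α - 1) * iteratedDeriv k u y

/-- Membership `ω ∈ 𝒰^{α,m}_{−1+}((−1,1))`: `ω ∈ W^{k,1}(−1,1)` and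
`^C D^α_{−1+} ω ∈ W^{m,1}(−1,1)`, with `L i` the (finite) right-hand limits
`D^i(^C D^α_{−1+} ω)(−1+)` for `i < m`. -/
def MemUL (k m : ℕ) (α : ℝ) (ω : ℝ → ℝ) (L : ℕ → ℝ) : Prop :=
  ContinuousOn ω (Icc (-1 : ℝ) 1) ∧
  (∀ i < k, ∀ x ∈ Ioo (-1 : ℝ) 1,
      HasDerivAt (iteratedDeriv i ω) (iteratedDeriv (i + 1) ω x) x) ∧
  (∀ i ≤ k, IntervalIntegrable (iteratedDeriv i ω) volume (-1) 1) ∧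
  (∀ i < m, ∀ x ∈ Ioo (-1 : ℝ) 1,
      HasDerivAt (iteratedDeriv i (caputoL k α (-1) ω))
        (iteratedDeriv (i + 1) (caputoL k α (-1) ω) x) x) ∧
  (∀ i ≤ m, IntervalIntegrable (iteratedDeriv i (caputoL k α (-1) ω)) volume (-1) 1) ∧
  (∀ i < m, Tendsto (iteratedDeriv i (caputoL k α (-1) ω))
      (nhdsWithin (-1 : ℝ) (Ioi (-1))) (nhds (L i)))

/-- The semi-norm `U^{α,m}_{−1+}(ω;(−1,1))`. -/
noncomputable def UsemiL (k m : ℕ) (α : ℝ) (ω : ℝ → ℝ) (L : ℕ → ℝ) : ℝ :=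
  (∫ x in (-1 : ℝ)..1, |iteratedDeriv m (caputoL k α (-1) ω) x|) +
    ∑ i ∈ Finset.range m, |L i|

/-- Coefficients `legendreCoeff n j / j!` are those of the Legendre polynomial `Pₙ(1 - 2y)`. -/
noncomputable def legendreCoeff (n : ℕ) : ℕ → ℝ
  | 0 => 1
  | j + 1 => legendreCoeff n j * ((j * (j + 1) - n * (n + 1)) / (j + 1))

/-- The Riemann–Liouville integral of order `γ` (based at `0`) of `y ↦ Pₙ(1 - 2y)`. -/
noncomputable def legendreInt (n : ℕ) (γ y : ℝ) : ℝ :=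
  ∑ j ∈ Finset.range (n + 1), legendreCoeff n j / Real.Gamma (j + 1 + γ) * y ^ ((j : ℝ) + γ)

theorem legendreCoeff_succ (n j : ℕ) :
    (j + 1) * legendreCoeff n (j + 1) = legendreCoeff n j * (j * (j + 1) - n * (n + 1)) := by
  rw [legendreCoeff]
  field_simp

theorem legendreCoeff_eq_zero {n j : ℕ} (h : n < j) : legendreCoeff n j = 0 := by
  induction j, h using Nat.le_induction with
  | base => simp [legendreCoeff]
  | succ j _ ih => rw [legendreCoeff, ih, zero_mul]

theorem legendreCoeff_add_two_succ (n j : ℕ) :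
    (j + 1) * legendreCoeff (n + 2) (j + 1)
      = -((n + j + 3) * (n + j + 2)) * legendreCoeff (n + 1) j := by
  induction j with
  | zero =>
    rw [legendreCoeff_succ]
    simp [legendreCoeff]
    ring
  | succ j ih =>
    have h1 := legendreCoeff_succ (n + 2) (j + 1)
    have h2 := legendreCoeff_succ (n + 1) j
    have h3 : (j : ℝ) + 1 ≠ 0 := by positivity
    apply mul_left_cancel₀ h3
    push_cast at *
    linear_combination (j + 1 : ℝ) * h1 + ((j + 1) * (j + 2) - (n + 2) * (n + 3) : ℝ) * ih
      + (n + j + 4) * (n + j + 3) * h2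

theorem legendreCoeff_self_succ (n j : ℕ) :
    (j + 1) * legendreCoeff n (j + 1)
      = -((n - j + 1) * (n - j)) * legendreCoeff (n + 1) j := by
  induction j with
  | zero =>
    rw [legendreCoeff_succ]
    simp [legendreCoeff]
    ring
  | succ j ih =>
    have h1 := legendreCoeff_succ n (j + 1)
    have h2 := legendreCoeff_succ (n + 1) j
    have h3 : (j : ℝ) + 1 ≠ 0 := by positivity
    apply mul_left_cancel₀ h3
    push_cast at *
    linear_combination (j + 1 : ℝ) * h1 + ((j + 1) * (j + 2) - n * (n + 1) : ℝ) * ih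
      + (n - j) * (n - j - 1) * h2

theorem legendreCoeff_recurrence (n j : ℕ) :
    legendreCoeff (n + 2) (j + 1) - legendreCoeff n (j + 1)
      = -(4 * n + 6) * legendreCoeff (n + 1) j := by
  have h1 := legendreCoeff_add_two_succ n j
  have h2 := legendreCoeff_self_succ n j
  have h3 : (j : ℝ) + 1 ≠ 0 := by positivity
  apply mul_left_cancel₀ h3
  linear_combination h1 - h2

theorem legendreInt_eq_sum {n N : ℕ} (h : n < N) (γ y : ℝ) :
    legendreInt n γ y = ∑ j ∈ Finset.range N,
      legendreCoeff n j / Real.Gamma (j + 1 + γ) * y ^ ((j : ℝ) + γ) := by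
  refine Finset.sum_subset (Finset.range_subset_range.2 h) fun j _ hj => ?_
  rw [legendreCoeff_eq_zero (by simpa using hj)]
  simp

theorem legendreInt_recurrence (n : ℕ) (γ y : ℝ) :
    legendreInt (n + 2) γ y - legendreInt n γ y
      = -(4 * n + 6) * legendreInt (n + 1) (γ + 1) y := by
  rw [legendreInt_eq_sum (show n + 2 < n + 3 by lia),
    legendreInt_eq_sum (show n < n + 3 by lia), ← Finset.sum_sub_distrib,
    Finset.sum_range_succ', legendreInt, Finset.mul_sum]
  have h0 : legendreCoeff (n + 2) 0 = legendreCoeff n 0 := by simp [legendreCoeff]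
  rw [h0, sub_self, add_zero]
  refine Finset.sum_congr rfl fun j _ => ?_
  have h1 := legendreCoeff_recurrence n j
  have h2 : ((j + 1 : ℕ) : ℝ) + γ = j + (γ + 1) := by push_cast; ring
  have h3 : ((j + 1 : ℕ) : ℝ) + 1 + γ = j + 1 + (γ + 1) := by push_cast; ring
  rw [h2, h3, ← sub_mul, ← sub_div, h1]
  ring

theorem legendreInt_one (n : ℕ) : ∀ {γ : ℝ}, 0 ≤ γ →
    legendreInt n γ 1 = (∏ i ∈ Finset.range n, (γ - 1 - i)) / Real.Gamma (γ + n + 1) := by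
  induction n using Nat.twoStepInduction with
  | zero =>
    intro γ _
    simp [legendreInt, legendreCoeff, add_comm]
  | one =>
    intro γ hγ
    have h1 : Real.Gamma (γ + 2) = (γ + 1) * Real.Gamma (γ + 1) := by
      rw [← Real.Gamma_add_one (by positivity)]; ring_nf
    have h2 : Real.Gamma (γ + 1) ≠ 0 := (Real.Gamma_pos_of_pos (by positivity)).ne'
    have h3 : γ + 1 ≠ 0 := by positivity
    simp only [legendreInt, legendreCoeff, Finset.sum_range_succ, Finset.prod_range_succ,
      Real.one_rpow]
    norm_num
    rw [show (1 : ℝ) + γ = γ + 1 by ring, show (2 : ℝ) + γ = γ + 2 by ring,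
      show γ + 1 + 1 = γ + 2 by ring, h1]
    field_simp
    ring
  | more n ih1 ih2 =>
    intro γ hγ
    have hr := legendreInt_recurrence n γ 1
    rw [ih1 hγ, ih2 (show 0 ≤ γ + 1 by positivity), sub_eq_iff_eq_add] at hr
    rw [hr]
    have hp : ∏ i ∈ Finset.range (n + 1), (γ + 1 - 1 - (i : ℝ))
        = (∏ i ∈ Finset.range n, (γ - 1 - i)) * γ := by
      rw [Finset.prod_range_succ']
      push_cast
      congr 1
      · exact Finset.prod_congr rfl fun i _ => by ring
      · ring
    rw [hp, Finset.prod_range_succ, Finset.prod_range_succ]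
    have e1 : Real.Gamma (γ + n + 2) = (γ + n + 1) * Real.Gamma (γ + n + 1) := by
      rw [← Real.Gamma_add_one (by positivity)]; ring_nf
    have e2 : Real.Gamma (γ + n + 3) = (γ + n + 2) * Real.Gamma (γ + n + 2) := by
      rw [← Real.Gamma_add_one (by positivity)]; ring_nf
    have h0 : Real.Gamma (γ + n + 1) ≠ 0 := (Real.Gamma_pos_of_pos (by positivity)).ne'
    have h1 : γ + n + 1 ≠ 0 := by positivity
    have h2 : γ + n + 2 ≠ 0 := by positivity
    push_cast
    rw [show γ + 1 + ((n : ℝ) + 1) + 1 = γ + n + 3 by ring,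
      show γ + ((n : ℝ) + 2) + 1 = γ + n + 3 by ring, e2, e1]
    field_simp
    ring

theorem legendreInt_zero_one (n : ℕ) : |legendreInt n 0 1| = 1 := by
  have h : ∀ n : ℕ, |∏ i ∈ Finset.range n, ((0 : ℝ) - 1 - i)| = (n.factorial : ℝ) := by
    intro n
    induction n with
    | zero => simp
    | succ n ih =>
      rw [Finset.prod_range_succ, abs_mul, ih, Nat.factorial_succ, abs_sub_comm, abs_of_nonneg]
      · push_cast; ring
      · have : (0 : ℝ) ≤ n := n.cast_nonneg
        linarith
  rw [legendreInt_one n le_rfl, abs_div, h, zero_add, Real.Gamma_nat_eq_factorial,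
    Nat.abs_cast, div_self (by positivity)]

theorem legendreInt_zero_zero (n : ℕ) : legendreInt n 0 0 = 1 := by
  rw [legendreInt, Finset.sum_range_succ']
  simp [legendreCoeff, Real.zero_rpow, Nat.cast_add_one_ne_zero]

theorem legendreInt_natCast_one {n j : ℕ} (h1 : 1 ≤ j) (h2 : j ≤ n) :
    legendreInt n j 1 = 0 := by
  rw [legendreInt_one n j.cast_nonneg, Finset.prod_eq_zero (i := j - 1), zero_div]
  · simp; lia
  · push_cast [h1]; ring

theorem legendreInt_apply_zero (n : ℕ) {γ : ℝ} (hγ : 0 < γ) : legendreInt n γ 0 = 0 := by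
  refine Finset.sum_eq_zero fun j _ => ?_
  rw [Real.zero_rpow (by positivity), mul_zero]

theorem continuous_legendreInt (n : ℕ) {γ : ℝ} (hγ : 0 ≤ γ) : Continuous (legendreInt n γ) := by
  refine continuous_finsetSum _ fun j _ => continuous_const.mul ?_
  exact Real.continuous_rpow_const (by positivity)

theorem measurable_legendreInt (n : ℕ) (γ : ℝ) : Measurable (legendreInt n γ) :=
  Finset.measurable_fun_sum _ fun j _ => by fun_prop

theorem hasDerivAt_legendreInt (n : ℕ) (γ : ℝ) {y : ℝ} (hy : 0 < y) :
    HasDerivAt (legendreInt n γ) (legendreInt n (γ - 1) y) y := by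
  refine HasDerivAt.fun_sum fun j _ => ?_
  have h := (Real.hasDerivAt_rpow_const (p := (j : ℝ) + γ) (Or.inl hy.ne')).const_mul
    (legendreCoeff n j / Real.Gamma (j + 1 + γ))
  refine h.congr_deriv (Eq.symm ?_)
  rcases eq_or_ne ((j : ℝ) + γ) 0 with h0 | h0
  · rw [show (j : ℝ) + 1 + (γ - 1) = 0 by linarith, h0]
    simp [Real.Gamma_zero]
  · rw [show (j : ℝ) + 1 + (γ - 1) = j + γ by ring,
      show (j : ℝ) + 1 + γ = j + γ + 1 by ring, Real.Gamma_add_one h0,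
      show (j : ℝ) + γ - 1 = j + (γ - 1) by ring]
    rcases eq_or_ne (Real.Gamma (j + γ)) 0 with h1 | h1
    · simp [h1]
    · field_simp

theorem exists_abs_legendreInt_le (n : ℕ) (γ : ℝ) :
    ∃ C, 0 ≤ C ∧ ∀ y, 0 < y → y ≤ 1 → |legendreInt n γ y| ≤ C * y ^ γ := by
  refine ⟨∑ j ∈ Finset.range (n + 1), |legendreCoeff n j / Real.Gamma (j + 1 + γ)|,
    Finset.sum_nonneg fun _ _ => abs_nonneg _, fun y hy hy1 => ?_⟩
  rw [legendreInt, Finset.sum_mul]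
  refine (Finset.abs_sum_le_sum_abs _ _).trans (Finset.sum_le_sum fun j _ => ?_)
  rw [abs_mul, abs_of_nonneg (Real.rpow_nonneg hy.le _)]
  refine mul_le_mul_of_nonneg_left ?_ (abs_nonneg _)
  exact Real.rpow_le_rpow_of_exponent_ge hy hy1 (by simp)

theorem legendreInt_half_ode (n : ℕ) {y : ℝ} (hy : 0 < y) :
    y * (1 - y) * legendreInt n (-(3 / 2)) y + (1 / 2 - y) * legendreInt n (-(1 / 2)) y
      + (n + 1 / 2) ^ 2 * legendreInt n (1 / 2) y = 0 := by
  have hG : ∀ j : ℕ, Real.Gamma ((j : ℝ) + 3 / 2) = (j + 1 / 2) * Real.Gamma (j + 1 / 2) := by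
    intro j
    rw [← Real.Gamma_add_one (by positivity)]; ring_nf
  have hG' : ∀ j : ℕ, Real.Gamma ((j : ℝ) + 1 / 2) = (j - 1 / 2) * Real.Gamma (j - 1 / 2) := by
    intro j
    have h : (j : ℝ) - 1 / 2 ≠ 0 := by
      intro h
      have h2 : ((2 * j : ℕ) : ℝ) = (1 : ℕ) := by push_cast; linarith
      have := Nat.cast_injective h2
      lia
    rw [← Real.Gamma_add_one h]; ring_nf
  have hpos : ∀ j : ℕ, Real.Gamma ((j : ℝ) + 1 / 2) ≠ 0 := fun j =>
    (Real.Gamma_pos_of_pos (by positivity)).ne'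
  set T : ℕ → ℝ := fun j =>
    legendreCoeff n j / Real.Gamma (j + 3 / 2) * (j * (j + 1 / 2)) * y ^ ((j : ℝ) - 1 / 2) with hT
  have key : ∀ j : ℕ,
      y * (1 - y) * (legendreCoeff n j / Real.Gamma (j + 1 + -(3 / 2)) * y ^ ((j : ℝ) + -(3 / 2)))
      + (1 / 2 - y) *
        (legendreCoeff n j / Real.Gamma (j + 1 + -(1 / 2)) * y ^ ((j : ℝ) + -(1 / 2)))
      + (n + 1 / 2) ^ 2 * (legendreCoeff n j / Real.Gamma (j + 1 + 1 / 2) * y ^ ((j : ℝ) + 1 / 2))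
      = T j - T (j + 1) := by
    intro j
    have e1 : y ^ ((j : ℝ) + 1 / 2) = y ^ ((j : ℝ) + -(3 / 2)) * (y * y) := by
      rw [show (j : ℝ) + 1 / 2 = j + -(3 / 2) + 2 by ring, Real.rpow_add hy]
      norm_num [sq]
    have e2 : y ^ ((j : ℝ) - 1 / 2) = y ^ ((j : ℝ) + -(3 / 2)) * y := by
      rw [show (j : ℝ) - 1 / 2 = j + -(3 / 2) + 1 by ring, Real.rpow_add_one hy.ne']
    have e3 : y ^ ((j : ℝ) + -(1 / 2)) = y ^ ((j : ℝ) + -(3 / 2)) * y := by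
      rw [← e2]; ring_nf
    have g1 : Real.Gamma ((j : ℝ) + 1 + -(3 / 2)) = Real.Gamma (j - 1 / 2) := by ring_nf
    have g2 : Real.Gamma ((j : ℝ) + 1 + -(1 / 2)) = (j - 1 / 2) * Real.Gamma (j - 1 / 2) := by
      rw [← hG']; ring_nf
    have g3 : Real.Gamma ((j : ℝ) + 1 + 1 / 2)
        = (j + 1 / 2) * ((j - 1 / 2) * Real.Gamma (j - 1 / 2)) := by
      rw [← hG', ← hG]; ring_nf
    have g4 : Real.Gamma ((j + 1 : ℕ) + 3 / 2)
        = (j + 3 / 2) * ((j + 1 / 2) * ((j - 1 / 2) * Real.Gamma (j - 1 / 2))) := by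
      rw [hG (j + 1), ← hG']
      push_cast
      rw [show (j : ℝ) + 1 + 1 / 2 = j + 3 / 2 by ring, hG]
    have g5 : Real.Gamma ((j : ℝ) + 3 / 2)
        = (j + 1 / 2) * ((j - 1 / 2) * Real.Gamma (j - 1 / 2)) := by
      rw [← hG', ← hG]
    have e4 : y ^ (((j + 1 : ℕ) : ℝ) - 1 / 2) = y ^ ((j : ℝ) + -(3 / 2)) * (y * y) := by
      rw [← e1]; push_cast; ring_nf
    have h1 := hpos j
    rw [hG'] at h1
    have h2 : (j : ℝ) - 1 / 2 ≠ 0 := left_ne_zero_of_mul h1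
    have h3 : Real.Gamma ((j : ℝ) - 1 / 2) ≠ 0 := right_ne_zero_of_mul h1
    have h4 : (j : ℝ) + 1 / 2 ≠ 0 := by positivity
    have h5 : (j : ℝ) + 3 / 2 ≠ 0 := by positivity
    simp only [hT]
    rw [g1, g2, g3, g4, g5, e1, e2, e3, e4]
    have hc := legendreCoeff_succ n j
    have h6 : (j : ℝ) * 2 - 1 ≠ 0 := fun h => h2 (by linarith)
    generalize Real.Gamma ((j : ℝ) - 1 / 2) = G at h3 ⊢
    obtain ⟨D, hD⟩ : ∃ D, D = legendreCoeff n j /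
        ((j + 1 / 2) * ((j - 1 / 2) * G)) := ⟨_, rfl⟩
    have q1 : legendreCoeff n j / G = D * ((j + 1 / 2) * (j - 1 / 2)) := by
      rw [hD]; field_simp
    have q2 : legendreCoeff n j / ((j - 1 / 2) * G) = D * (j + 1 / 2) := by
      rw [hD]; field_simp
    have q3 : legendreCoeff n (j + 1) / ((j + 3 / 2) * ((j + 1 / 2) * ((j - 1 / 2) *
        G))) * ((j + 1 : ℕ) * ((j + 1 : ℕ) + 1 / 2))
        = D * (j * (j + 1) - n * (n + 1)) := by
      rw [hD, div_mul_eq_mul_div _ _ (_ - _), ← hc]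
      push_cast
      rw [show (j : ℝ) + 1 + 1 / 2 = j + 3 / 2 by ring]
      field_simp
    rw [q1, q2, q3, ← hD]
    ring
  simp only [legendreInt, Finset.mul_sum, ← Finset.sum_add_distrib]
  rw [Finset.sum_congr rfl fun j _ => key j, Finset.sum_range_sub']
  simp [hT, legendreCoeff_eq_zero]

theorem legendreInt_half_energy (n : ℕ) {y : ℝ} (hy : 0 < y) :
    (n + 1 / 2) ^ 2 * legendreInt n (1 / 2) y ^ 2
      + y * (1 - y) * legendreInt n (-(1 / 2)) y ^ 2 = 1 / Real.pi := by
  set B : ℝ → ℝ := fun y =>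
    ∑ j ∈ Finset.range (n + 1), legendreCoeff n j / Real.Gamma (j + 1 + -(1 / 2)) * y ^ j with hB
  have hBc : Continuous B := by fun_prop
  have hBeq : ∀ z, 0 < z → (1 - z) * B z ^ 2 = z * (1 - z) * legendreInt n (-(1 / 2)) z ^ 2 := by
    intro z hz
    have h : legendreInt n (-(1 / 2)) z = z ^ (-(1 / 2) : ℝ) * B z := by
      rw [hB, legendreInt, Finset.mul_sum]
      refine Finset.sum_congr rfl fun j _ => ?_
      rw [Real.rpow_add hz, Real.rpow_natCast]
      ring
    have h2 : z * (z ^ (-(1 / 2) : ℝ)) ^ 2 = 1 := by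
      rw [← Real.rpow_natCast, ← Real.rpow_mul hz.le]
      norm_num
      rw [Real.rpow_neg_one, mul_inv_cancel₀ hz.ne']
    rw [h]
    linear_combination -(1 - z) * B z ^ 2 * h2
  set E : ℝ → ℝ := fun z => (n + 1 / 2) ^ 2 * legendreInt n (1 / 2) z ^ 2 + (1 - z) * B z ^ 2
    with hE
  have hEc : Continuous E := by
    have := continuous_legendreInt n (γ := 1 / 2) (by norm_num)
    fun_prop
  have hEd : ∀ z, 0 < z → HasDerivAt E 0 z := by
    intro z hz
    have h1 := hasDerivAt_legendreInt n (1 / 2) hz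
    have h2 := hasDerivAt_legendreInt n (-(1 / 2)) hz
    rw [show (1 / 2 : ℝ) - 1 = -(1 / 2) by norm_num] at h1
    rw [show (-(1 / 2) : ℝ) - 1 = -(3 / 2) by norm_num] at h2
    have h3 := ((h1.pow 2).const_mul ((n + 1 / 2 : ℝ) ^ 2)).add
      (((hasDerivAt_id z).mul ((hasDerivAt_const z (1 : ℝ)).sub (hasDerivAt_id z))).mul (h2.pow 2))
    have h4 := legendreInt_half_ode n hz
    refine (h3.congr_of_eventuallyEq ?_).congr_deriv ?_
    · filter_upwards [lt_mem_nhds hz] with w hw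
      simp only [hE]
      rw [hBeq w hw]
      simp
    · simp only [Pi.pow_apply, Pi.mul_apply, Pi.sub_apply, id]
      push_cast
      linear_combination 2 * legendreInt n (-(1 / 2)) z * h4
  obtain ⟨c, hc, hc'⟩ := exists_hasDerivAt_eq_slope E (fun _ => 0) hy hEc.continuousOn
    fun z hz => hEd z hz.1
  have hE0 : E 0 = 1 / Real.pi := by
    have : B 0 = 1 / Real.sqrt Real.pi := by
      simp only [hB]
      rw [Finset.sum_range_succ']
      simp [legendreCoeff]
      norm_num [Real.Gamma_one_half_eq]
    simp only [hE]
    rw [legendreInt_apply_zero n (by norm_num), this]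
    norm_num [Real.sq_sqrt Real.pi_pos.le]
  have h5 : E y = E 0 := by
    have : E y - E 0 = 0 := by
      rcases div_eq_zero_iff.1 hc'.symm with h | h
      · exact h
      · linarith
    linarith
  rw [← hBeq y hy, ← hE0, ← h5]

theorem abs_legendreInt_half_le (n : ℕ) {y : ℝ} (hy : 0 ≤ y) (hy1 : y ≤ 1) :
    |legendreInt n (1 / 2) y| ≤ 2 / (n + 1) := by
  rcases hy.eq_or_lt with rfl | hy
  · rw [legendreInt_apply_zero n (by norm_num), abs_zero]
    positivity
  have h := legendreInt_half_energy n hy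
  have h1 : 0 ≤ y * (1 - y) * legendreInt n (-(1 / 2)) y ^ 2 := by
    have : 0 ≤ 1 - y := by linarith
    positivity
  have h2 : 1 / Real.pi ≤ 1 := by
    rw [div_le_one Real.pi_pos]; linarith [Real.pi_gt_three]
  have h3 : ((n + 1 / 2) * |legendreInt n (1 / 2) y|) ^ 2 ≤ 1 ^ 2 := by
    rw [mul_pow, sq_abs]; linarith
  have h4 := abs_le_of_sq_le_sq h3 zero_le_one
  have h6 := abs_nonneg (legendreInt n (1 / 2) y)
  rw [le_div_iff₀ (by positivity)]
  have : (0 : ℝ) ≤ n := n.cast_nonneg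
  nlinarith [(abs_le.1 h4).2]

theorem abs_legendreInt_neg_half_le (n : ℕ) {y : ℝ} (hy : 0 < y) (hy1 : y < 1) :
    |legendreInt n (-(1 / 2)) y| ≤ y ^ (-(1 / 2) : ℝ) + (1 - y) ^ (-(1 / 2) : ℝ) := by
  have h := legendreInt_half_energy n hy
  have hy' : 0 < 1 - y := by linarith
  have h1 : 0 ≤ (n + 1 / 2 : ℝ) ^ 2 * legendreInt n (1 / 2) y ^ 2 := by positivity
  have h2 : 1 / Real.pi ≤ 1 := by
    rw [div_le_one Real.pi_pos]; linarith [Real.pi_gt_three]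
  have hs : ∀ z : ℝ, 0 < z → z * (z ^ (-(1 / 2) : ℝ)) ^ 2 = 1 := by
    intro z hz
    rw [← Real.rpow_natCast, ← Real.rpow_mul hz.le]
    norm_num
    rw [Real.rpow_neg_one, mul_inv_cancel₀ hz.ne']
  have ha := hs y hy
  have hb := hs _ hy'
  have pa := Real.rpow_nonneg hy.le (-(1 / 2))
  have pb := Real.rpow_nonneg hy'.le (-(1 / 2))
  set a := y ^ (-(1 / 2) : ℝ)
  set b := (1 - y) ^ (-(1 / 2) : ℝ)
  refine abs_le_of_sq_le_sq' ?_ (by positivity) |> abs_le.2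
  have hyy : 0 < y * (1 - y) := mul_pos hy hy'
  refine le_of_mul_le_mul_left ?_ hyy
  have hab : y * (1 - y) * (a + b) ^ 2 = 1 + 2 * (y * (1 - y)) * (a * b) := by
    linear_combination (1 - y) * ha + y * hb
  rw [hab]
  have : 0 ≤ 2 * (y * (1 - y)) * (a * b) := by positivity
  linarith

theorem integral_sub_rpow_mul_sub_rpow {a b s t : ℝ} (hab : a < b) (hs : 0 < s) (ht : 0 < t) :
    ∫ v in a..b, (b - v) ^ (s - 1) * (v - a) ^ (t - 1)
      = (b - a) ^ (s + t - 1) * ProbabilityTheory.beta s t := by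
  have h0 : ∫ v in a..b, (b - v) ^ (s - 1) * (v - a) ^ (t - 1)
      = ∫ v in (0 : ℝ)..(b - a), v ^ (t - 1) * ((b - a) - v) ^ (s - 1) := by
    rw [← sub_self a, ← intervalIntegral.integral_comp_sub_right]
    refine intervalIntegral.integral_congr fun v _ => ?_
    rw [show b - a - (v - a) = b - v by ring, mul_comm]
  have hpos : 0 < b - a := sub_pos.2 hab
  have h1 := Complex.betaIntegral_scaled (t : ℂ) (s : ℂ) hpos
  have h2 : ∫ x in (0 : ℝ)..(b - a), (x : ℂ) ^ ((t : ℂ) - 1) * (((b - a : ℝ) : ℂ) - x) ^ ((s : ℂ) - 1)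
      = ((∫ v in (0 : ℝ)..(b - a), v ^ (t - 1) * ((b - a) - v) ^ (s - 1) : ℝ) : ℂ) := by
    rw [← intervalIntegral.integral_ofReal]
    refine intervalIntegral.integral_congr fun v hv => ?_
    rw [uIcc_of_le hpos.le] at hv
    push_cast
    rw [Complex.ofReal_cpow hv.1, Complex.ofReal_cpow (by linarith [hv.2])]
    push_cast
    rfl
  rw [h2] at h1
  have h3 := congrArg Complex.re h1
  rw [Complex.ofReal_re, ← Complex.ofReal_one, ← Complex.ofReal_add, ← Complex.ofReal_sub,
    ← Complex.ofReal_cpow hpos.le, Complex.re_ofReal_mul,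
    ← ProbabilityTheory.beta_eq_betaIntegralReal t s ht hs] at h3
  rw [h0, h3, ProbabilityTheory.beta, ProbabilityTheory.beta]
  ring_nf

theorem intervalIntegrable_sub_rpow_mul_sub_rpow {a b s t : ℝ} (hab : a < b) (hs : 0 < s)
    (ht : 0 < t) :
    IntervalIntegrable (fun v => (b - v) ^ (s - 1) * (v - a) ^ (t - 1)) volume a b := by
  by_contra h
  have h1 := integral_sub_rpow_mul_sub_rpow hab hs ht
  rw [intervalIntegral.integral_undef h] at h1
  have h2 := ProbabilityTheory.beta_pos hs ht
  have h3 := Real.rpow_pos_of_pos (sub_pos.2 hab) (s + t - 1)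
  exact (mul_pos h3 h2).ne h1

theorem integral_sub_rpow {a b s : ℝ} (hab : a < b) (hs : 0 < s) :
    ∫ v in a..b, (b - v) ^ (s - 1) = (b - a) ^ s / s := by
  have h := integral_sub_rpow_mul_sub_rpow hab hs one_pos
  simp only [sub_self, Real.rpow_zero, mul_one, add_sub_cancel_right] at h
  rw [h, ProbabilityTheory.beta, Real.Gamma_one, Real.Gamma_add_one hs.ne']
  have := (Real.Gamma_pos_of_pos hs).ne'
  field_simp

theorem intervalIntegrable_sub_rpow {a b s : ℝ} (hab : a < b) (hs : 0 < s) :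
    IntervalIntegrable (fun v => (b - v) ^ (s - 1)) volume a b := by
  simpa using intervalIntegrable_sub_rpow_mul_sub_rpow hab hs one_pos

theorem intervalIntegrable_sub_rpow_mul_legendreInt (n : ℕ) {γ θ y : ℝ} (hγ : -1 < γ) (hθ : 0 < θ)
    (hy : 0 < y) :
    IntervalIntegrable (fun v => (y - v) ^ (θ - 1) * legendreInt n γ v) volume 0 y := by
  simp only [legendreInt, Finset.mul_sum]
  rw [← Finset.sum_fn]
  refine IntervalIntegrable.sum (ε := ℝ) _ fun j _ => ?_
  have hj : 0 < (j : ℝ) + γ + 1 := by linarith [j.cast_nonneg (α := ℝ)]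
  have := (intervalIntegrable_sub_rpow_mul_sub_rpow hy hθ hj).const_mul
    (legendreCoeff n j / Real.Gamma (j + 1 + γ))
  refine this.congr fun v _ => ?_
  simp only [sub_zero, add_sub_cancel_right]
  ring

theorem integral_sub_rpow_mul_legendreInt (n : ℕ) {γ θ y : ℝ} (hγ : -1 < γ) (hθ : 0 < θ)
    (hy : 0 < y) :
    ∫ v in (0 : ℝ)..y, (y - v) ^ (θ - 1) * legendreInt n γ v
      = Real.Gamma θ * legendreInt n (γ + θ) y := by
  have hpos : ∀ j : ℕ, 0 < (j : ℝ) + γ + 1 := fun j => by linarith [j.cast_nonneg (α := ℝ)]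
  have hterm : ∀ (j : ℕ) (v : ℝ), (y - v) ^ (θ - 1) *
      (legendreCoeff n j / Real.Gamma (j + 1 + γ) * v ^ ((j : ℝ) + γ))
      = legendreCoeff n j / Real.Gamma (j + 1 + γ) *
        ((y - v) ^ (θ - 1) * (v - 0) ^ ((j : ℝ) + γ + 1 - 1)) := fun j v => by
    simp only [sub_zero, add_sub_cancel_right]
    ring
  simp only [legendreInt, Finset.mul_sum]
  simp_rw [hterm]
  rw [intervalIntegral.integral_finsetSum fun j _ =>
    (intervalIntegrable_sub_rpow_mul_sub_rpow hy hθ (hpos j)).const_mul _]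
  refine Finset.sum_congr rfl fun j _ => ?_
  rw [intervalIntegral.integral_const_mul, integral_sub_rpow_mul_sub_rpow hy hθ (hpos j), sub_zero,
    ProbabilityTheory.beta, show (j : ℝ) + 1 + γ = j + γ + 1 by ring,
    show (j : ℝ) + 1 + (γ + θ) = θ + (j + γ + 1) by ring,
    show θ + ((j : ℝ) + γ + 1) - 1 = j + (γ + θ) by ring]
  have := (Real.Gamma_pos_of_pos (hpos j)).ne'
  field_simp

theorem abs_integral_sub_rpow_mul_le {θ y δ B M : ℝ} (hθ1 : θ < 1) (hδ : 0 < δ)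
    (hy : 0 < y) {f F : ℝ → ℝ} (hF : ContinuousOn F (Icc 0 y)) (hF0 : F 0 = 0)
    (hFf : ∀ v ∈ Ioo 0 y, HasDerivAt F (f v) v) (hf : IntervalIntegrable f volume 0 y)
    (hkf : IntervalIntegrable (fun v => (y - v) ^ (θ - 1) * f v) volume 0 y)
    (hB : ∀ v ∈ Icc 0 y, |F v| ≤ B)
    (hM : ∀ a, 0 ≤ a → a < y → y - a ≤ δ → |∫ v in a..y, (y - v) ^ (θ - 1) * f v| ≤ M) :
    |∫ v in (0 : ℝ)..y, (y - v) ^ (θ - 1) * f v| ≤ M + 2 * B * δ ^ (θ - 1) := by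
  have hB0 : 0 ≤ B := (abs_nonneg _).trans (hB 0 ⟨le_rfl, hy.le⟩)
  have hδ' : 0 ≤ δ ^ (θ - 1) := Real.rpow_nonneg hδ.le _
  rcases le_or_gt y δ with h | h
  · have := hM 0 le_rfl hy (by simpa using h)
    nlinarith [mul_nonneg hB0 hδ']
  obtain ⟨a, ha⟩ : ∃ a, a = y - δ := ⟨_, rfl⟩
  have ha0 : 0 < a := by linarith
  have hay : a < y := by linarith
  have hsub1 : uIcc 0 a ⊆ uIcc 0 y := by
    rw [uIcc_of_le ha0.le, uIcc_of_le hy.le]; exact Icc_subset_Icc_right hay.le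
  have hsub2 : uIcc a y ⊆ uIcc 0 y := by
    rw [uIcc_of_le hay.le, uIcc_of_le hy.le]; exact Icc_subset_Icc_left ha0.le
  rw [← intervalIntegral.integral_add_adjacent_intervals (hkf.mono_set hsub1)
    (hkf.mono_set hsub2), add_comm]
  refine (abs_add_le _ _).trans (add_le_add (hM a ha0.le hay (by linarith)) ?_)
  have hne : ∀ v ∈ Icc 0 a, y - v ≠ 0 := fun v hv => by linarith [hv.2]
  have hder : ∀ v ∈ Icc 0 a,
      HasDerivAt (fun v => (y - v) ^ (θ - 1)) ((1 - θ) * (y - v) ^ (θ - 1 - 1)) v := by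
    intro v hv
    have := ((hasDerivAt_id v).const_sub y).rpow_const (p := θ - 1) (Or.inl (hne v hv))
    refine this.congr_deriv ?_
    simp only [id]
    ring
  have hcu : ContinuousOn (fun v => (y - v) ^ (θ - 1)) (uIcc 0 a) := by
    rw [uIcc_of_le ha0.le]
    exact fun v hv => (hder v hv).continuousAt.continuousWithinAt
  have hcu' : ContinuousOn (fun v => (1 - θ) * (y - v) ^ (θ - 1 - 1)) (uIcc 0 a) := by
    rw [uIcc_of_le ha0.le]
    exact continuousOn_const.mul ((continuousOn_const.sub continuousOn_id).rpow_const
      fun v hv => Or.inl (hne v hv))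
  have hiu' : IntervalIntegrable (fun v => (1 - θ) * (y - v) ^ (θ - 1 - 1)) volume 0 a :=
    hcu'.intervalIntegrable
  have hFa : ContinuousOn F (uIcc 0 a) := by
    rw [uIcc_of_le ha0.le]; exact hF.mono (Icc_subset_Icc_right hay.le)
  have hmin : Ioo (min 0 a) (max 0 a) = Ioo 0 a := by
    rw [min_eq_left ha0.le, max_eq_right ha0.le]
  rw [intervalIntegral.integral_mul_deriv_eq_deriv_mul_of_hasDerivAt hcu hFa
    (fun v hv => hder v (Ioo_subset_Icc_self (hmin ▸ hv)))
    (fun v hv => hFf v (Ioo_subset_Ioo_right hay.le (hmin ▸ hv)))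
    hiu' (hf.mono_set hsub1), hF0, mul_zero, sub_zero]
  have hya : y - a = δ := by linarith
  rw [hya]
  have h1 : |∫ v in (0 : ℝ)..a, (1 - θ) * (y - v) ^ (θ - 1 - 1) * F v|
      ≤ ∫ v in (0 : ℝ)..a, (1 - θ) * (y - v) ^ (θ - 1 - 1) * B := by
    rw [← Real.norm_eq_abs]
    refine intervalIntegral.norm_integral_le_of_norm_le ha0.le (ae_of_all _ fun v hv => ?_)
      (hiu'.mul_const B)
    have h2 : 0 ≤ (1 - θ) * (y - v) ^ (θ - 1 - 1) :=
      mul_nonneg (by linarith) (Real.rpow_nonneg (by linarith [hv.2]) _)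
    rw [Real.norm_eq_abs, abs_mul, abs_of_nonneg h2]
    exact mul_le_mul_of_nonneg_left (hB v ⟨hv.1.le, hv.2.trans hay.le⟩) h2
  rw [intervalIntegral.integral_mul_const, intervalIntegral.integral_eq_sub_of_hasDerivAt
    (fun v hv => hder v (by rwa [uIcc_of_le ha0.le] at hv)) hiu', hya] at h1
  have h3 : 0 ≤ (y - 0) ^ (θ - 1) := Real.rpow_nonneg (by linarith) _
  have h4 : |δ ^ (θ - 1) * F a| ≤ δ ^ (θ - 1) * B := by
    rw [abs_mul, abs_of_nonneg hδ']
    exact mul_le_mul_of_nonneg_left (hB a ⟨ha0.le, hay.le⟩) hδ'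
  refine (abs_sub _ _).trans ?_
  nlinarith [mul_nonneg h3 hB0]

theorem exists_abs_legendreInt_natCast_add_half_le (j : ℕ) :
    ∃ C, 0 ≤ C ∧ ∀ n, j ≤ n → ∀ y, 0 ≤ y → y ≤ 1 →
      |legendreInt n (j + 1 / 2) y| ≤ C / (n + 1) ^ (j + 1) := by
  induction j with
  | zero =>
    refine ⟨2, by norm_num, fun n _ y hy hy1 => ?_⟩
    simpa using abs_legendreInt_half_le n hy hy1
  | succ j ih =>
    obtain ⟨C, hC0, hC⟩ := ih
    refine ⟨C * 2 ^ (j + 1), by positivity, fun n hn y hy hy1 => ?_⟩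
    obtain ⟨n, rfl⟩ : ∃ k, n = k + 1 := ⟨n - 1, by lia⟩
    have hr := legendreInt_recurrence n (j + 1 / 2) y
    have h1 := hC n (by lia) y hy hy1
    have h2 := hC (n + 2) (by lia) y hy hy1
    have h3 : C / ((n + 2 : ℕ) + 1) ^ (j + 1) ≤ C / ((n : ℝ) + 1) ^ (j + 1) := by
      gcongr
      simp
    have h4 : C / ((n : ℝ) + 1) ^ (j + 1) ≤ C * 2 ^ (j + 1) / (n + 2) ^ (j + 1) := by
      rw [div_le_div_iff₀ (by positivity) (by positivity), mul_assoc, ← mul_pow]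
      gcongr
      linarith [n.cast_nonneg (α := ℝ)]
    have h5 : (4 * n + 6) * |legendreInt (n + 1) (j + 1 / 2 + 1) y|
        ≤ 2 * (C * 2 ^ (j + 1) / (n + 2) ^ (j + 1)) := by
      have : |-(4 * (n : ℝ) + 6)| = 4 * n + 6 := by rw [abs_neg, abs_of_nonneg (by positivity)]
      rw [← this, ← abs_mul, ← hr]
      refine (abs_sub _ _).trans ?_
      linarith
    push_cast
    rw [show (j : ℝ) + 1 + 1 / 2 = j + 1 / 2 + 1 by ring, show (n : ℝ) + 1 + 1 = n + 2 by ring,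
      pow_succ _ (j + 1), ← div_div, le_div_iff₀ (by positivity)]
    nlinarith [abs_nonneg (legendreInt (n + 1) (j + 1 / 2 + 1) y), n.cast_nonneg (α := ℝ)]

theorem abs_integral_sub_rpow_mul_legendreInt_neg_half_le (n : ℕ) {a y θ : ℝ} (ha : 0 ≤ a)
    (hay : a < y) (hy1 : y ≤ 1) (hθ : 1 / 2 < θ) (hθ1 : θ < 1) :
    |∫ v in a..y, (y - v) ^ (θ - 1) * legendreInt n (-(1 / 2)) v|
      ≤ (ProbabilityTheory.beta θ (1 / 2) + 1 / (θ - 1 / 2)) * (y - a) ^ (θ - 1 / 2) := by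
  have h1 := integral_sub_rpow_mul_sub_rpow hay (by linarith : 0 < θ) (by norm_num : (0 : ℝ) < 1 / 2)
  have h2 := integral_sub_rpow hay (by linarith : 0 < θ - 1 / 2)
  have i1 := intervalIntegrable_sub_rpow_mul_sub_rpow hay (by linarith : 0 < θ)
    (by norm_num : (0 : ℝ) < 1 / 2)
  have i2 := intervalIntegrable_sub_rpow hay (by linarith : 0 < θ - 1 / 2)
  have h3 : |∫ v in a..y, (y - v) ^ (θ - 1) * legendreInt n (-(1 / 2)) v|
      ≤ ∫ v in a..y, ((y - v) ^ (θ - 1) * (v - a) ^ ((1 / 2 : ℝ) - 1)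
        + (y - v) ^ (θ - 1 / 2 - 1)) := by
    rw [← Real.norm_eq_abs]
    refine intervalIntegral.norm_integral_le_of_norm_le hay.le (ae_of_all _ fun v hv => ?_)
      (i1.add i2)
    rw [Real.norm_eq_abs, abs_mul, abs_of_nonneg (Real.rpow_nonneg (by linarith [hv.2]) _)]
    rcases hv.2.eq_or_lt with rfl | hvy
    · rw [sub_self, Real.zero_rpow (by linarith), zero_mul, zero_mul, zero_add]
      exact Real.rpow_nonneg le_rfl _
    have hv0 : 0 < v - a := sub_pos.2 hv.1
    have hyv : 0 < y - v := sub_pos.2 hvy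
    have h4 := abs_legendreInt_neg_half_le n (ha.trans_lt hv.1) (hvy.trans_le hy1)
    have h5 : v ^ (-(1 / 2) : ℝ) ≤ (v - a) ^ (-(1 / 2) : ℝ) :=
      Real.rpow_le_rpow_of_nonpos hv0 (by linarith) (by norm_num)
    have h6 : (1 - v) ^ (-(1 / 2) : ℝ) ≤ (y - v) ^ (-(1 / 2) : ℝ) :=
      Real.rpow_le_rpow_of_nonpos hyv (by linarith) (by norm_num)
    rw [show θ - 1 / 2 - 1 = (θ - 1) + -(1 / 2) by ring, Real.rpow_add hyv,
      show (1 / 2 : ℝ) - 1 = -(1 / 2) by norm_num, ← mul_add]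
    exact mul_le_mul_of_nonneg_left (by linarith) (Real.rpow_nonneg hyv.le _)
  rw [intervalIntegral.integral_add i1 i2, h1, h2,
    show θ + 1 / 2 - 1 = θ - 1 / 2 by ring] at h3
  refine h3.trans (le_of_eq ?_)
  ring

theorem exists_abs_legendreInt_le_of_lt_half {β : ℝ} (hβ : 0 < β) (hβ1 : β < 1 / 2) :
    ∃ C, 0 ≤ C ∧ ∀ n : ℕ, ∀ y, 0 ≤ y → y ≤ 1 →
      |legendreInt n β y| ≤ C * ((n : ℝ) + 1) ^ (-(2 * β)) := by
  obtain ⟨K, hK⟩ : ∃ K, K = ProbabilityTheory.beta (β + 1 / 2) (1 / 2) + 1 / β := ⟨_, rfl⟩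
  have hK0 : 0 ≤ K := by
    have := ProbabilityTheory.beta_pos (α := β + 1 / 2) (β := 1 / 2) (by linarith) (by norm_num)
    rw [hK]; positivity
  have hG : 0 < Real.Gamma (β + 1 / 2) := Real.Gamma_pos_of_pos (by linarith)
  refine ⟨(K + 4) / Real.Gamma (β + 1 / 2), by positivity, fun n y hy hy1 => ?_⟩
  have hN : (0 : ℝ) < n + 1 := by positivity
  rcases hy.eq_or_lt with rfl | hy
  · rw [legendreInt_apply_zero n hβ, abs_zero]; positivity
  have h := integral_sub_rpow_mul_legendreInt n (by norm_num : (-1 : ℝ) < -(1 / 2))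
    (by linarith : 0 < β + 1 / 2) hy
  rw [show -(1 / 2) + (β + 1 / 2) = β by ring] at h
  have hi := intervalIntegrable_sub_rpow_mul_legendreInt n (by norm_num : (-1 : ℝ) < -(1 / 2))
    (by linarith : 0 < β + 1 / 2) hy
  have hf : IntervalIntegrable (legendreInt n (-(1 / 2))) volume 0 y := by
    simpa using intervalIntegrable_sub_rpow_mul_legendreInt n
      (by norm_num : (-1 : ℝ) < -(1 / 2)) (by linarith : (0 : ℝ) < 1) hy
  have key := abs_integral_sub_rpow_mul_le (by linarith : β + 1 / 2 < 1)
    (by positivity : (0 : ℝ) < ((n : ℝ) + 1) ^ (-2 : ℝ)) hy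
    (continuous_legendreInt n (by norm_num : (0 : ℝ) ≤ 1 / 2)).continuousOn
    (legendreInt_apply_zero n (by norm_num))
    (fun v hv => (hasDerivAt_legendreInt n (1 / 2) hv.1).congr_deriv (by norm_num))
    hf hi (fun v hv => abs_legendreInt_half_le n hv.1 (hv.2.trans hy1))
    (M := K * ((n : ℝ) + 1) ^ (-(2 * β))) (fun a ha hay had => by
      refine (abs_integral_sub_rpow_mul_legendreInt_neg_half_le n ha hay hy1
        (by linarith) (by linarith)).trans ?_
      rw [show β + 1 / 2 - 1 / 2 = β by ring, ← hK, show -(2 * β) = -2 * β by ring,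
        Real.rpow_mul hN.le]
      exact mul_le_mul_of_nonneg_left (Real.rpow_le_rpow (by linarith) had hβ.le) hK0)
  rw [h, abs_mul, abs_of_pos hG, ← Real.rpow_mul hN.le,
    show (2 : ℝ) * (2 / (n + 1)) = 4 * (n + 1) ^ (-1 : ℝ) by
      rw [Real.rpow_neg_one]; ring, mul_assoc, ← Real.rpow_add hN,
    show (-1 : ℝ) + -2 * (β + 1 / 2 - 1) = -(2 * β) by ring] at key
  rw [div_mul_eq_mul_div, le_div_iff₀ hG]
  linarith

theorem exists_abs_legendreInt_le_of_half_le {β : ℝ} (hβ : 1 / 2 ≤ β) :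
    ∃ C, 0 ≤ C ∧ ∀ n : ℕ, β < n → ∀ y, 0 ≤ y → y ≤ 1 →
      |legendreInt n β y| ≤ C * ((n : ℝ) + 1) ^ (-(β + 1 / 2)) := by
  obtain ⟨j, hj⟩ : ∃ j, j = ⌊β - 1 / 2⌋₊ := ⟨_, rfl⟩
  have hj1 : (j : ℝ) ≤ β - 1 / 2 := hj ▸ Nat.floor_le (by linarith)
  have hj2 : β - 1 / 2 < j + 1 := hj ▸ Nat.lt_floor_add_one _
  obtain ⟨A, hA0, hA⟩ := exists_abs_legendreInt_natCast_add_half_le j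
  obtain ⟨B, hB0, hB⟩ := exists_abs_legendreInt_natCast_add_half_le (j + 1)
  rcases hj1.eq_or_lt with hj1 | hj1
  · refine ⟨A, hA0, fun n hn y hy hy1 => ?_⟩
    have hjn : j ≤ n := by exact_mod_cast (by linarith : (j : ℝ) ≤ n)
    have h := hA n hjn y hy hy1
    have e : β + 1 / 2 = ((j + 1 : ℕ) : ℝ) := by push_cast; linarith
    rw [Real.rpow_neg (by positivity), e, Real.rpow_natCast, ← div_eq_mul_inv,
      show β = j + 1 / 2 by linarith]
    exact h
  obtain ⟨θ, hθ⟩ : ∃ θ, θ = β - 1 / 2 - j := ⟨_, rfl⟩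
  have hθ0 : 0 < θ := by linarith
  have hθ1 : θ < 1 := by linarith
  have hG : 0 < Real.Gamma θ := Real.Gamma_pos_of_pos hθ0
  refine ⟨(A / θ + 2 * B) / Real.Gamma θ, by positivity, fun n hn y hy hy1 => ?_⟩
  have hN : (0 : ℝ) < n + 1 := by positivity
  rcases hy.eq_or_lt with rfl | hy
  · rw [legendreInt_apply_zero n (by linarith), abs_zero]; positivity
  have hjn : j + 1 ≤ n := by
    have : j < n := by exact_mod_cast (by linarith : (j : ℝ) < n)
    exact this
  have hγ : (-1 : ℝ) < j + 1 / 2 := by linarith [j.cast_nonneg (α := ℝ)]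
  have hγ0 : (0 : ℝ) ≤ j + 1 / 2 := by positivity
  have hγ1 : (0 : ℝ) < (j + 1 : ℕ) + 1 / 2 := by positivity
  have h := integral_sub_rpow_mul_legendreInt n hγ hθ0 hy
  rw [show (j : ℝ) + 1 / 2 + θ = β by rw [hθ]; ring] at h
  have hi := intervalIntegrable_sub_rpow_mul_legendreInt n hγ hθ0 hy
  have hf : IntervalIntegrable (legendreInt n (j + 1 / 2)) volume 0 y :=
    (continuous_legendreInt n hγ0).intervalIntegrable _ _
  have key := abs_integral_sub_rpow_mul_le hθ1
    (by positivity : (0 : ℝ) < ((n : ℝ) + 1)⁻¹) hy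
    (continuous_legendreInt n hγ1.le).continuousOn
    (legendreInt_apply_zero n hγ1)
    (fun v hv => (hasDerivAt_legendreInt n _ hv.1).congr_deriv
      (by rw [show ((j + 1 : ℕ) : ℝ) + 1 / 2 - 1 = j + 1 / 2 by push_cast; ring]))
    hf hi (fun v hv => hB n hjn v hv.1 (hv.2.trans hy1))
    (M := A / (n + 1) ^ (j + 1) * (((n : ℝ) + 1)⁻¹ ^ θ / θ)) (fun a ha hay had => by
      have i2 := intervalIntegrable_sub_rpow hay hθ0
      have h2 : |∫ v in a..y, (y - v) ^ (θ - 1) * legendreInt n (j + 1 / 2) v|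
          ≤ ∫ v in a..y, A / (n + 1) ^ (j + 1) * (y - v) ^ (θ - 1) := by
        rw [← Real.norm_eq_abs]
        refine intervalIntegral.norm_integral_le_of_norm_le hay.le (ae_of_all _ fun v hv => ?_)
          (i2.const_mul _)
        rw [Real.norm_eq_abs, abs_mul, abs_of_nonneg (Real.rpow_nonneg (by linarith [hv.2]) _),
          mul_comm]
        exact mul_le_mul_of_nonneg_right (hA n (by lia) v (ha.trans hv.1.le) (hv.2.trans hy1))
          (Real.rpow_nonneg (by linarith [hv.2]) _)
      rw [intervalIntegral.integral_const_mul, integral_sub_rpow hay hθ0] at h2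
      refine h2.trans ?_
      gcongr)
  have e1 : ((n : ℝ) + 1) ^ (-(β + 1 / 2)) = 1 / (n + 1) ^ (j + 1) * ((n : ℝ) + 1)⁻¹ ^ θ := by
    rw [Real.inv_rpow hN.le, ← Real.rpow_neg hN.le, ← Real.rpow_natCast, one_div ((n + 1 : ℝ) ^ _),
      ← Real.rpow_neg hN.le, ← Real.rpow_add hN, hθ]
    push_cast; ring_nf
  have e2 : 2 * (B / ((n : ℝ) + 1) ^ (j + 1 + 1)) * ((n : ℝ) + 1)⁻¹ ^ (θ - 1)
      = 2 * B * ((n : ℝ) + 1) ^ (-(β + 1 / 2)) := by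
    rw [e1, Real.rpow_sub_one (by positivity)]
    field_simp
    ring
  rw [h, abs_mul, abs_of_pos hG, e2] at key
  rw [div_mul_eq_mul_div, le_div_iff₀ hG, mul_comm]
  refine key.trans (le_of_eq ?_)
  rw [e1]; ring

theorem exists_abs_legendreInt_le_rpow {β : ℝ} (hβ : 0 < β) :
    ∃ C, 0 ≤ C ∧ ∀ n : ℕ, β < n → ∀ y, 0 ≤ y → y ≤ 1 →
      |legendreInt n β y| ≤ C * ((n : ℝ) + 1) ^ (-(min (2 * β) (β + 1 / 2))) := by
  rcases lt_or_ge β (1 / 2) with h | h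
  · obtain ⟨C, hC0, hC⟩ := exists_abs_legendreInt_le_of_lt_half hβ h
    refine ⟨C, hC0, fun n _ y hy hy1 => ?_⟩
    rw [min_eq_left (by linarith)]
    exact hC n y hy hy1
  · obtain ⟨C, hC0, hC⟩ := exists_abs_legendreInt_le_of_half_le h
    refine ⟨C, hC0, fun n hn y hy hy1 => ?_⟩
    rw [min_eq_right (by linarith)]
    exact hC n hn y hy hy1

theorem two_mul_le_log_sub_log {t : ℝ} (ht : 0 ≤ t) (ht1 : t < 1) :
    2 * t ≤ Real.log (1 + t) - Real.log (1 - t) := by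
  have h := Real.hasSum_log_sub_log_of_abs_lt_one (by rwa [abs_of_nonneg ht])
  have := h.summable.sum_le_tsum {0} (fun i _ => by positivity)
  rw [h.tsum_eq] at this
  simpa using this

theorem abs_sub_div_add_le_rpow {γ N : ℝ} (hγ : 0 < γ) (hγN : γ < N) :
    |γ - N| / (γ + N) ≤ (N / (N + 1)) ^ (2 * γ) := by
  have hN0 : 0 < N := by linarith
  have hpos : 0 < N / (N + 1) := by positivity
  have h1 : -(1 / N) ≤ Real.log (N / (N + 1)) := by
    have := Real.one_sub_inv_le_log_of_pos hpos
    refine le_trans (le_of_eq ?_) this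
    field_simp
    ring
  have h2 := two_mul_le_log_sub_log (div_pos hγ hN0).le ((div_lt_one hN0).2 hγN)
  have h3 : 0 < 1 - γ / N := sub_pos.2 ((div_lt_one hN0).2 hγN)
  have h4 : 0 < 1 + γ / N := by positivity
  have h5 : |γ - N| / (γ + N) = (1 - γ / N) / (1 + γ / N) := by
    rw [abs_sub_comm, abs_of_nonneg (by linarith)]
    field_simp
    ring
  rw [h5, ← Real.log_le_log_iff (by positivity) (by positivity), Real.log_div h3.ne' h4.ne',
    Real.log_rpow hpos]
  have h6 := mul_le_mul_of_nonneg_left h1 (by positivity : 0 ≤ 2 * γ)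
  have h7 : 2 * γ * -(1 / N) = -(2 * (γ / N)) := by ring
  linarith

theorem legendreInt_succ_one (n : ℕ) {γ : ℝ} (hγ : 0 < γ) :
    legendreInt (n + 1) γ 1 = legendreInt n γ 1 * ((γ - (n + 1)) / (γ + (n + 1))) := by
  rw [legendreInt_one _ hγ.le, legendreInt_one _ hγ.le, Finset.prod_range_succ,
    show γ + ((n + 1 : ℕ) : ℝ) + 1 = γ + (n + 1) + 1 by push_cast; ring,
    Real.Gamma_add_one (by positivity), ← add_assoc γ]
  have : Real.Gamma (γ + n + 1) ≠ 0 := (Real.Gamma_pos_of_pos (by positivity)).ne'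
  have : γ + n + 1 ≠ 0 := by positivity
  field_simp
  ring

theorem exists_abs_legendreInt_one_le {γ : ℝ} (hγ : 0 < γ) :
    ∃ C, 0 ≤ C ∧ ∀ n : ℕ, |legendreInt n γ 1| ≤ C * ((n : ℝ) + 1) ^ (-(2 * γ)) := by
  obtain ⟨M, hM⟩ := exists_nat_gt γ
  have hb : ∀ n : ℕ, 0 < ((n : ℝ) + 1) ^ (-(2 * γ)) := fun n => by positivity
  have hstep : ∀ d : ℕ, |legendreInt (M + d) γ 1|
      ≤ |legendreInt M γ 1| / ((M : ℝ) + 1) ^ (-(2 * γ))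
        * (((M + d : ℕ) : ℝ) + 1) ^ (-(2 * γ)) := by
    intro d
    induction d with
    | zero => exact le_of_eq (div_mul_cancel₀ _ (hb M).ne').symm
    | succ d ih =>
      obtain ⟨n, hn⟩ : ∃ n, n = M + d := ⟨_, rfl⟩
      have hγn : γ < (n : ℝ) + 1 := by
        rw [hn]; push_cast; linarith [d.cast_nonneg (α := ℝ)]
      have h := abs_sub_div_add_le_rpow hγ hγn
      rw [← add_assoc, ← hn, legendreInt_succ_one n hγ, abs_mul, abs_div,
        abs_of_pos (by positivity : 0 < γ + ((n : ℝ) + 1))]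
      rw [← hn] at ih
      refine (mul_le_mul ih h (by positivity) (mul_nonneg (by positivity) (hb n).le)).trans
        (le_of_eq ?_)
      have hN : (0 : ℝ) < n + 1 := by positivity
      rw [Real.div_rpow hN.le (by positivity), Real.rpow_neg hN.le, Nat.cast_succ,
        Real.rpow_neg (by positivity : (0 : ℝ) ≤ n + 1 + 1)]
      have : ((n : ℝ) + 1) ^ (2 * γ) ≠ 0 := by positivity
      field_simp
  refine ⟨∑ i ∈ Finset.range (M + 1), |legendreInt i γ 1| / ((i : ℝ) + 1) ^ (-(2 * γ)),
    Finset.sum_nonneg fun i _ => by positivity, fun n => ?_⟩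
  have hle : ∀ i ∈ Finset.range (M + 1), |legendreInt i γ 1| / ((i : ℝ) + 1) ^ (-(2 * γ))
      ≤ ∑ i ∈ Finset.range (M + 1), |legendreInt i γ 1| / ((i : ℝ) + 1) ^ (-(2 * γ)) :=
    fun i hi => Finset.single_le_sum
      (f := fun i : ℕ => |legendreInt i γ 1| / ((i : ℝ) + 1) ^ (-(2 * γ)))
      (fun i _ => by positivity) hi
  rcases lt_or_ge n M with h | h
  · rw [← div_le_iff₀ (hb n)]
    exact hle n (Finset.mem_range.2 (by lia))
  · obtain ⟨d, rfl⟩ := Nat.exists_eq_add_of_le h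
    exact (hstep d).trans (mul_le_mul_of_nonneg_right
      (hle M (Finset.mem_range.2 (by lia))) (hb _).le)

/-- The right-sided Riemann–Liouville integral of order `γ` (based at `1`) of the Legendre
polynomial `Pₙ` on `[-1, 1]`. -/
noncomputable def legendreKernel (n : ℕ) (γ x : ℝ) : ℝ :=
  2 ^ γ * legendreInt n γ ((1 - x) / 2)

theorem hasDerivAt_legendreKernel (n : ℕ) (γ : ℝ) {x : ℝ} (hx : x < 1) :
    HasDerivAt (legendreKernel n γ) (-legendreKernel n (γ - 1) x) x := by
  have h1 : HasDerivAt (fun x : ℝ => (1 - x) / 2) (-1 / 2) x :=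
    ((hasDerivAt_id x).const_sub 1).div_const 2
  have h2 := ((hasDerivAt_legendreInt n γ (by linarith : 0 < (1 - x) / 2)).comp x h1).const_mul
    ((2 : ℝ) ^ γ)
  refine h2.congr_deriv ?_
  rw [legendreKernel, Real.rpow_sub_one two_ne_zero]
  ring

theorem continuous_legendreKernel (n : ℕ) {γ : ℝ} (hγ : 0 ≤ γ) :
    Continuous (legendreKernel n γ) :=
  continuous_const.mul ((continuous_legendreInt n hγ).comp (by fun_prop))

theorem measurable_legendreKernel (n : ℕ) (γ : ℝ) : Measurable (legendreKernel n γ) :=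
  ((measurable_legendreInt n γ).comp (by fun_prop)).const_mul _

theorem legendreKernel_one (n : ℕ) {γ : ℝ} (hγ : 0 < γ) : legendreKernel n γ 1 = 0 := by
  simp [legendreKernel, legendreInt_apply_zero n hγ]

theorem legendreKernel_neg_one (n : ℕ) (γ : ℝ) :
    legendreKernel n γ (-1) = 2 ^ γ * legendreInt n γ 1 := by
  norm_num [legendreKernel]

theorem legendreKernel_natCast_neg_one {n j : ℕ} (hj : 1 ≤ j) (hjn : j ≤ n) :
    legendreKernel n j (-1) = 0 := by
  rw [legendreKernel_neg_one, legendreInt_natCast_one hj hjn, mul_zero]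

theorem intervalIntegrable_legendreKernel (n : ℕ) {γ : ℝ} (hγ : -1 < γ) :
    IntervalIntegrable (legendreKernel n γ) volume (-1) 1 := by
  have h : IntervalIntegrable (legendreInt n γ) volume 0 1 := by
    simpa using intervalIntegrable_sub_rpow_mul_legendreInt n hγ one_pos one_pos
  have h2 := ((h.comp_mul_left (c := 1 / 2)).comp_sub_left 1).symm.const_mul ((2 : ℝ) ^ γ)
  norm_num at h2
  refine h2.congr (fun x _ => ?_)
  simp only [legendreKernel]
  ring_nf

theorem exists_abs_legendreKernel_le (n : ℕ) (γ : ℝ) :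
    ∃ C, 0 ≤ C ∧ ∀ x ∈ Ico (-1 : ℝ) 1, |legendreKernel n γ x| ≤ C * (1 - x) ^ γ := by
  obtain ⟨C, hC0, hC⟩ := exists_abs_legendreInt_le n γ
  refine ⟨C, hC0, fun x hx => ?_⟩
  have h := hC ((1 - x) / 2) (by linarith [hx.2]) (by linarith [hx.1])
  have h2 : (0 : ℝ) < 2 ^ γ := by positivity
  rw [Real.div_rpow (by linarith [hx.2]) two_pos.le] at h
  rw [legendreKernel, abs_mul, abs_of_pos h2]
  refine (mul_le_mul_of_nonneg_left h h2.le).trans (le_of_eq ?_)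
  field_simp

theorem exists_continuousOn_eqOn_of_hasDerivAt {f f' : ℝ → ℝ} {a b : ℝ} (hab : a < b)
    (hf : ∀ x ∈ Ioo a b, HasDerivAt f (f' x) x) (hf' : IntervalIntegrable f' volume a b) :
    ∃ g, ContinuousOn g (Icc a b) ∧ EqOn f g (Ioo a b) := by
  obtain ⟨c, hc⟩ := exists_between hab
  refine ⟨fun x => f c + ∫ t in c..x, f' t, ?_, fun x hx => ?_⟩
  · have := intervalIntegral.continuousOn_primitive_interval' hf'
      (by rw [uIcc_of_le hab.le]; exact ⟨hc.1.le, hc.2.le⟩ : c ∈ uIcc a b)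
    rw [uIcc_of_le hab.le] at this
    exact continuousOn_const.add this
  · have hsub : uIcc c x ⊆ Ioo a b := ordConnected_Ioo.uIcc_subset hc hx
    show f x = f c + ∫ t in c..x, f' t
    rw [intervalIntegral.integral_eq_sub_of_hasDerivAt (fun t ht => hf t (hsub ht))
      (hf'.mono_set (hsub.trans (Ioo_subset_Icc_self.trans Icc_subset_uIcc)))]
    ring

theorem exists_integral_mul_legendreKernel {f f' : ℝ → ℝ}
    (hf : ∀ x ∈ Ioo (-1 : ℝ) 1, HasDerivAt f (f' x) x)
    (hf' : IntervalIntegrable f' volume (-1) 1) :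
    ∃ c, (∀ L, Tendsto f (nhdsWithin (-1) (Ioi (-1))) (nhds L) → c = L) ∧
      ∀ (n : ℕ) (γ : ℝ), -1 < γ → ∫ x in (-1 : ℝ)..1, f x * legendreKernel n γ x
        = c * legendreKernel n (γ + 1) (-1)
          + ∫ x in (-1 : ℝ)..1, f' x * legendreKernel n (γ + 1) x := by
  have h11 : (-1 : ℝ) < 1 := by norm_num
  obtain ⟨g, hg, hfg⟩ := exists_continuousOn_eqOn_of_hasDerivAt h11 hf hf'
  refine ⟨g (-1), fun L hL => ?_, fun n γ hγ => ?_⟩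
  · have h1 : Tendsto g (nhdsWithin (-1) (Ioo (-1) 1)) (nhds (g (-1))) :=
      (hg (-1) ⟨le_rfl, h11.le⟩).mono_left (nhdsWithin_mono _ Ioo_subset_Icc_self)
    have h2 : Tendsto f (nhdsWithin (-1) (Ioo (-1) 1)) (nhds (g (-1))) :=
      h1.congr' (eventually_nhdsWithin_of_forall fun x hx => (hfg hx).symm)
    rw [nhdsWithin_Ioo_eq_nhdsGT h11] at h2
    exact tendsto_nhds_unique h2 hL
  · have h1 : ∫ x in (-1 : ℝ)..1, f x * legendreKernel n γ x
        = ∫ x in (-1 : ℝ)..1, g x * legendreKernel n γ x := by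
      simp only [intervalIntegral.integral_of_le h11.le, integral_Ioc_eq_integral_Ioo]
      exact setIntegral_congr_fun measurableSet_Ioo fun x hx => by
        show f x * _ = g x * _
        rw [hfg hx]
    have hg' : ∀ x ∈ Ioo (-1 : ℝ) 1, HasDerivAt g (f' x) x := fun x hx =>
      (hf x hx).congr_of_eventuallyEq
        (eventually_of_mem (Ioo_mem_nhds hx.1 hx.2) fun t ht => (hfg ht).symm)
    have hv : ∀ x ∈ Ioo (-1 : ℝ) 1, HasDerivAt (fun x => -legendreKernel n (γ + 1) x)
        (legendreKernel n γ x) x := fun x hx =>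
      (hasDerivAt_legendreKernel n (γ + 1) hx.2).neg.congr_deriv (by
        rw [neg_neg, add_sub_cancel_right])
    have hmin : Ioo (min (-1 : ℝ) 1) (max (-1) 1) = Ioo (-1) 1 := by
      rw [min_eq_left h11.le, max_eq_right h11.le]
    rw [h1, intervalIntegral.integral_mul_deriv_eq_deriv_mul_of_hasDerivAt
      (by rwa [uIcc_of_le h11.le])
      (continuous_legendreKernel n (by linarith)).neg.continuousOn
      (hmin ▸ hg') (hmin ▸ hv) hf' (intervalIntegrable_legendreKernel n hγ)]
    simp only [Pi.neg_apply, legendreKernel_one n (by linarith : 0 < γ + 1)]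
    simp

theorem integral_mul_legendreKernel_of_tendsto {f f' : ℝ → ℝ} {L : ℝ}
    (hf : ∀ x ∈ Ioo (-1 : ℝ) 1, HasDerivAt f (f' x) x)
    (hf' : IntervalIntegrable f' volume (-1) 1)
    (hL : Tendsto f (nhdsWithin (-1) (Ioi (-1))) (nhds L)) (n : ℕ) {γ : ℝ} (hγ : -1 < γ) :
    ∫ x in (-1 : ℝ)..1, f x * legendreKernel n γ x = L * legendreKernel n (γ + 1) (-1)
      + ∫ x in (-1 : ℝ)..1, f' x * legendreKernel n (γ + 1) x := by
  obtain ⟨c, hc, h⟩ := exists_integral_mul_legendreKernel hf hf'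
  rw [← hc L hL]
  exact h n γ hγ

theorem integral_mul_legendreKernel_natCast {f f' : ℝ → ℝ}
    (hf : ∀ x ∈ Ioo (-1 : ℝ) 1, HasDerivAt f (f' x) x)
    (hf' : IntervalIntegrable f' volume (-1) 1) {n j : ℕ} (hj : j + 1 ≤ n) :
    ∫ x in (-1 : ℝ)..1, f x * legendreKernel n j x
      = ∫ x in (-1 : ℝ)..1, f' x * legendreKernel n (j + 1 : ℕ) x := by
  obtain ⟨c, -, h⟩ := exists_integral_mul_legendreKernel hf hf'
  rw [h n j (by linarith [j.cast_nonneg (α := ℝ)]), ← Nat.cast_succ,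
    legendreKernel_natCast_neg_one (by lia) hj, mul_zero, zero_add]

theorem integral_eval_mul_legendreKernel_eq_zero {n d j : ℕ} (hd : d + j < n) {R : Polynomial ℝ}
    (hR : R.natDegree ≤ d) : ∫ x in (-1 : ℝ)..1, R.eval x * legendreKernel n j x = 0 := by
  induction d generalizing j R with
  | zero =>
    rw [integral_mul_legendreKernel_natCast (fun x _ => R.hasDerivAt x)
      (R.derivative.continuous.intervalIntegrable _ _) (by lia),
      Polynomial.derivative_of_natDegree_zero (by lia)]
    simp
  | succ d ih =>
    rw [integral_mul_legendreKernel_natCast (fun x _ => R.hasDerivAt x)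
      (R.derivative.continuous.intervalIntegrable _ _) (by lia)]
    exact ih (by lia) ((Polynomial.natDegree_derivative_le R).trans (by lia))

theorem exists_polynomial_eq_legendreKernel_zero (n : ℕ) :
    ∃ Q : Polynomial ℝ, Q.natDegree ≤ n ∧ ∀ x, Q.eval x = legendreKernel n 0 x := by
  refine ⟨∑ j ∈ Finset.range (n + 1), Polynomial.C (legendreCoeff n j / Real.Gamma (j + 1 + 0))
    * (Polynomial.C (1 / 2) * (1 - Polynomial.X)) ^ j, ?_, fun x => ?_⟩
  · refine Polynomial.natDegree_sum_le_of_forall_le _ _ fun j hj => ?_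
    have h1 : (Polynomial.C (1 / 2) * (1 - Polynomial.X) : Polynomial ℝ).natDegree ≤ 1 := by
      compute_degree
    refine (Polynomial.natDegree_C_mul_le _ _).trans (Polynomial.natDegree_pow_le.trans ?_)
    have := Finset.mem_range.1 hj
    nlinarith
  · rw [Polynomial.eval_finsetSum, legendreKernel, legendreInt, Real.rpow_zero, one_mul]
    refine Finset.sum_congr rfl fun j _ => ?_
    simp only [Polynomial.eval_mul, Polynomial.eval_C, Polynomial.eval_pow, Polynomial.eval_sub,
      Polynomial.eval_one, Polynomial.eval_X, add_zero, Real.rpow_natCast]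
    ring_nf

theorem integral_deriv_mul_legendreKernel_zero {ω ω' : ℝ → ℝ} {n : ℕ} (hn : 1 ≤ n)
    (hω : ContinuousOn ω (Icc (-1) 1)) (hd : ∀ x ∈ Ioo (-1 : ℝ) 1, HasDerivAt ω (ω' x) x)
    (hi : IntervalIntegrable ω' volume (-1) 1) {P : Polynomial ℝ} (hP : P.natDegree ≤ n)
    (hort : ∀ v : Polynomial ℝ, v.natDegree < n →
      ∫ x in (-1 : ℝ)..1, (P.eval x - ω x) * v.eval x = 0) :
    ∫ x in (-1 : ℝ)..1, ω' x * legendreKernel n 0 x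
      = (ω 1 - P.eval 1) * legendreKernel n 0 1
        - (ω (-1) - P.eval (-1)) * legendreKernel n 0 (-1) := by
  have h11 : (-1 : ℝ) ≤ 1 := by norm_num
  obtain ⟨Q, hQ, hQK⟩ := exists_polynomial_eq_legendreKernel_zero n
  have hP' : ∫ x in (-1 : ℝ)..1, P.derivative.eval x * Q.eval x = 0 := by
    have := integral_eval_mul_legendreKernel_eq_zero (n := n) (d := n - 1) (j := 0) (by lia)
      ((Polynomial.natDegree_derivative_le P).trans (by lia))
    simpa [hQK] using this
  have ho := hort Q.derivative (lt_of_le_of_lt (Polynomial.natDegree_derivative_le Q) (by lia))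
  have hmin : Ioo (min (-1 : ℝ) 1) (max (-1) 1) = Ioo (-1) 1 := by
    rw [min_eq_left h11, max_eq_right h11]
  have hiP : IntervalIntegrable (fun x => P.derivative.eval x) volume (-1) 1 :=
    P.derivative.continuous.intervalIntegrable _ _
  have hparts := intervalIntegral.integral_mul_deriv_eq_deriv_mul_of_hasDerivAt
    (u := fun x => Q.eval x) (v := fun x => ω x - P.eval x) (a := -1) (b := 1)
    (u' := fun x => Q.derivative.eval x) (v' := fun x => ω' x - P.derivative.eval x)
    Q.continuous.continuousOn (by rw [uIcc_of_le h11]; exact hω.sub P.continuous.continuousOn)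
    (fun x _ => Q.hasDerivAt x)
    (hmin ▸ fun x hx => (hd x hx).sub (P.hasDerivAt x))
    (Q.derivative.continuous.intervalIntegrable _ _) (hi.sub hiP)
  have e1 : ∫ x in (-1 : ℝ)..1, Q.derivative.eval x * (ω x - P.eval x) = 0 := by
    rw [← neg_eq_zero, ← ho, ← intervalIntegral.integral_neg]
    exact intervalIntegral.integral_congr fun x _ => by ring
  have e2 : ∫ x in (-1 : ℝ)..1, Q.eval x * (ω' x - P.derivative.eval x)
      = ∫ x in (-1 : ℝ)..1, ω' x * Q.eval x := by
    rw [← sub_zero (∫ x in (-1 : ℝ)..1, ω' x * Q.eval x), ← hP',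
      ← intervalIntegral.integral_sub (hi.mul_continuousOn Q.continuous.continuousOn)
        (hiP.mul_continuousOn Q.continuous.continuousOn)]
    exact intervalIntegral.integral_congr fun x _ => by ring
  rw [e1, e2] at hparts
  simp only [← hQK]
  rw [hparts]
  ring

theorem abs_legendreKernel_zero_one (n : ℕ) : |legendreKernel n 0 1| = 1 := by
  simp [legendreKernel, legendreInt_zero_zero]

theorem abs_legendreKernel_zero_neg_one (n : ℕ) : |legendreKernel n 0 (-1)| = 1 := by
  simp [legendreKernel_neg_one, legendreInt_zero_one]

theorem integral_sub_rpow_mul_legendreKernel (n : ℕ) {γ θ x : ℝ} (hγ : -1 < γ) (hθ : 0 < θ)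
    (hx : x < 1) :
    ∫ z in x..1, (z - x) ^ (θ - 1) * legendreKernel n γ z
      = Real.Gamma θ * legendreKernel n (γ + θ) x := by
  have h := integral_sub_rpow_mul_legendreInt n hγ hθ (by linarith : 0 < (1 - x) / 2)
  have h2 := intervalIntegral.integral_comp_sub_div (a := x) (b := 1)
    (fun v => ((1 - x) / 2 - v) ^ (θ - 1) * legendreInt n γ v) two_ne_zero (1 / 2)
  rw [show (1 / 2 - 1 / 2 : ℝ) = 0 by norm_num, show 1 / 2 - x / 2 = (1 - x) / 2 by ring, h,
    smul_eq_mul] at h2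
  have h3 : ∫ z in x..1, (z - x) ^ (θ - 1) * legendreKernel n γ z
      = ∫ z in x..1, 2 ^ (γ + θ - 1)
        * (((1 - x) / 2 - (1 / 2 - z / 2)) ^ (θ - 1) * legendreInt n γ (1 / 2 - z / 2)) := by
    refine intervalIntegral.integral_congr fun z hz => ?_
    rw [uIcc_of_le hx.le] at hz
    show (z - x) ^ (θ - 1) * (2 ^ γ * legendreInt n γ ((1 - z) / 2)) = _
    rw [show (1 - x) / 2 - (1 / 2 - z / 2) = (z - x) / 2 by ring,
      show (1 - z) / 2 = 1 / 2 - z / 2 by ring, Real.div_rpow (by linarith [hz.1]) two_pos.le,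
      show γ + θ - 1 = γ + (θ - 1) by ring, Real.rpow_add two_pos]
    have : (2 : ℝ) ^ (θ - 1) ≠ 0 := by positivity
    field_simp
  rw [h3, intervalIntegral.integral_const_mul, h2, legendreKernel, Real.rpow_sub_one two_ne_zero]
  ring

theorem integrable_prod_mul_of_integral_norm_le {X Y : Type*} [MeasurableSpace X]
    [MeasurableSpace Y] {μ : Measure X} {ν : Measure Y} [SFinite μ] [SFinite ν]
    {Φ : X → Y → ℝ} {w : Y → ℝ} (hΦ : Measurable (Function.uncurry Φ)) (hw : Integrable w ν)
    {C : ℝ} (hi : ∀ᵐ y ∂ν, Integrable (fun x => Φ x y) μ)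
    (hC : ∀ᵐ y ∂ν, ∫ x, |Φ x y| ∂μ ≤ C) :
    Integrable (Function.uncurry fun x y => Φ x y * w y) (μ.prod ν) := by
  have hm : AEStronglyMeasurable (Function.uncurry fun x y => Φ x y * w y) (μ.prod ν) :=
    hΦ.aestronglyMeasurable.mul hw.aestronglyMeasurable.comp_snd
  rw [integrable_prod_iff' hm]
  refine ⟨hi.mono fun y hy => hy.mul_const (w y), ?_⟩
  refine (hw.norm.const_mul C).mono' ?_ (hC.mono fun y hy => ?_)
  · exact hm.norm.prod_swap.integral_prod_right'
  · simp only [Function.uncurry_apply_pair, norm_mul, integral_mul_const,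
      Real.norm_eq_abs, abs_abs]
    rw [abs_of_nonneg (integral_nonneg fun x => abs_nonneg _)]
    exact mul_le_mul_of_nonneg_right hy (abs_nonneg _)

theorem exists_integral_abs_sub_rpow_mul_legendreKernel_le (n : ℕ) {α θ : ℝ} (hα : 0 < α)
    (hθ : 0 < θ) (hαθ : 1 ≤ α + θ) :
    ∃ C, ∀ y ∈ Ioo (-1 : ℝ) 1,
      IntegrableOn (fun x => (x - y) ^ (θ - 1) * legendreKernel n (α - 1) x) (Ioo y 1) ∧
      ∫ x in Ioo y 1, |(x - y) ^ (θ - 1) * legendreKernel n (α - 1) x| ≤ C := by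
  obtain ⟨C, hC0, hC⟩ := exists_abs_legendreKernel_le n (α - 1)
  have hb := ProbabilityTheory.beta_pos hα hθ
  refine ⟨C * (2 ^ (α + θ - 1) * ProbabilityTheory.beta α θ), fun y hy => ?_⟩
  have hi := (intervalIntegrable_sub_rpow_mul_sub_rpow hy.2 hα hθ).const_mul C
  have he := integral_sub_rpow_mul_sub_rpow hy.2 hα hθ
  rw [intervalIntegral.integral_of_le hy.2.le, integral_Ioc_eq_integral_Ioo] at he
  rw [intervalIntegrable_iff_integrableOn_Ioo_of_le hy.2.le] at hi
  have hm : Measurable fun x => (x - y) ^ (θ - 1) * legendreKernel n (α - 1) x :=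
    (((measurable_id.sub_const y).pow_const _)).mul (measurable_legendreKernel n _)
  have hle : ∀ x ∈ Ioo y 1, |(x - y) ^ (θ - 1) * legendreKernel n (α - 1) x|
      ≤ C * ((1 - x) ^ (α - 1) * (x - y) ^ (θ - 1)) := by
    intro x hx
    have h1 : 0 ≤ (x - y) ^ (θ - 1) := Real.rpow_nonneg (by linarith [hx.1]) _
    rw [abs_mul, abs_of_nonneg h1, ← mul_assoc, mul_comm]
    exact mul_le_mul_of_nonneg_right (hC x ⟨by linarith [hx.1, hy.1], hx.2⟩) h1
  have hInt : IntegrableOn (fun x => (x - y) ^ (θ - 1) * legendreKernel n (α - 1) x) (Ioo y 1) :=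
    Integrable.mono' hi hm.aestronglyMeasurable
      ((ae_restrict_iff' measurableSet_Ioo).2 (ae_of_all _ hle))
  refine ⟨hInt, (setIntegral_mono_on hInt.abs hi measurableSet_Ioo hle).trans ?_⟩
  rw [integral_const_mul, he]
  have h1 : 1 - y ≤ 2 := by linarith [hy.1]
  have h2 : 0 ≤ 1 - y := by linarith [hy.2]
  gcongr

theorem integral_riemannLiouville_mul_legendreKernel (n : ℕ) {α θ : ℝ} (hα : 0 < α) (hθ : 0 < θ)
    (hαθ : 1 ≤ α + θ) {w : ℝ → ℝ} (hw : IntervalIntegrable w volume (-1) 1) :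
    ∫ x in (-1 : ℝ)..1, (∫ y in (-1 : ℝ)..x, (x - y) ^ (θ - 1) * w y)
        * legendreKernel n (α - 1) x
      = Real.Gamma θ * ∫ y in (-1 : ℝ)..1, w y * legendreKernel n (α + θ - 1) y := by
  have h11 : (-1 : ℝ) ≤ 1 := by norm_num
  rw [intervalIntegrable_iff_integrableOn_Ioo_of_le h11] at hw
  obtain ⟨C, hC⟩ := exists_integral_abs_sub_rpow_mul_legendreKernel_le n hα hθ hαθ
  obtain ⟨Φ, hΦ⟩ : ∃ Φ : ℝ → ℝ → ℝ, Φ = fun x y =>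
    (Ioi y).indicator (fun x => (x - y) ^ (θ - 1) * legendreKernel n (α - 1) x) x := ⟨_, rfl⟩
  have hΦm : Measurable (Function.uncurry Φ) := by
    have : Function.uncurry Φ = {q : ℝ × ℝ | q.2 < q.1}.indicator
        (fun q => (q.1 - q.2) ^ (θ - 1) * legendreKernel n (α - 1) q.1) := by
      ext ⟨x, y⟩
      simp [hΦ, indicator]
    rw [this]
    exact (((measurable_fst.sub measurable_snd).pow_const _).mul
      ((measurable_legendreKernel n _).comp measurable_fst)).indicator
      (measurableSet_lt measurable_snd measurable_fst)
  have hset : ∀ y ∈ Ioo (-1 : ℝ) 1, Ioi y ∩ Ioo (-1) 1 = Ioo y 1 := fun y hy => by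
    ext x
    simp only [mem_inter_iff, mem_Ioi, mem_Ioo]
    exact ⟨fun h => ⟨h.1, h.2.2⟩, fun h => ⟨h.1, hy.1.trans h.1, h.2⟩⟩
  have hInt : Integrable (Function.uncurry fun x y => Φ x y * w y)
      ((volume.restrict (Ioo (-1) 1)).prod (volume.restrict (Ioo (-1) 1))) := by
    refine integrable_prod_mul_of_integral_norm_le (C := C) hΦm hw
      ((ae_restrict_iff' measurableSet_Ioo).2 (ae_of_all _ fun y hy => ?_))
      ((ae_restrict_iff' measurableSet_Ioo).2 (ae_of_all _ fun y hy => ?_))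
    · rw [hΦ, integrable_indicator_iff measurableSet_Ioi, IntegrableOn,
        Measure.restrict_restrict measurableSet_Ioi, hset y hy]
      exact (hC y hy).1
    · refine le_trans (le_of_eq ?_) (hC y hy).2
      rw [← hset y hy, ← Measure.restrict_restrict measurableSet_Ioi,
        ← integral_indicator measurableSet_Ioi]
      refine integral_congr_ae (ae_of_all _ fun x => ?_)
      by_cases hx : y < x <;> simp [hΦ, indicator, hx]
  have hswap := integral_integral_swap hInt
  simp only [intervalIntegral.integral_of_le h11, integral_Ioc_eq_integral_Ioo]
  rw [← integral_const_mul]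
  convert hswap using 1
  · refine setIntegral_congr_fun measurableSet_Ioo fun x hx => ?_
    have hs : Iio x ∩ Ioo (-1) 1 = Ioo (-1) x := by
      ext y
      simp only [mem_inter_iff, mem_Iio, mem_Ioo]
      exact ⟨fun h => ⟨h.2.1, h.1⟩, fun h => ⟨h.2, h.1, h.2.trans hx.2⟩⟩
    rw [intervalIntegral.integral_of_le hx.1.le, integral_Ioc_eq_integral_Ioo, ← hs,
      ← Measure.restrict_restrict measurableSet_Iio, ← integral_indicator measurableSet_Iio,
      ← integral_mul_const]
    refine integral_congr_ae (ae_of_all _ fun y => ?_)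
    by_cases hxy : y < x
    · simp only [hΦ, indicator, mem_Iio, mem_Ioi, hxy, if_true]
      ring
    · simp [hΦ, indicator, hxy]
  · refine setIntegral_congr_fun measurableSet_Ioo fun y hy => ?_
    have h := integral_sub_rpow_mul_legendreKernel n (by linarith : -1 < α - 1) hθ hy.2
    rw [integral_mul_const, hΦ, integral_indicator measurableSet_Ioi,
      Measure.restrict_restrict measurableSet_Ioi, hset y hy, ← integral_Ioc_eq_integral_Ioo,
      ← intervalIntegral.integral_of_le hy.2.le, h, show α - 1 + θ = α + θ - 1 by ring]
    ring

theorem integral_caputoL_mul_legendreKernel {k : ℕ} (hk : 1 ≤ k) {α : ℝ} (hα : 0 < α)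
    (hαk : α < k) {ω : ℝ → ℝ} (hω : IntervalIntegrable (iteratedDeriv k ω) volume (-1) 1) (n : ℕ) :
    ∫ x in (-1 : ℝ)..1, caputoL k α (-1) ω x * legendreKernel n (α - 1) x
      = ∫ x in (-1 : ℝ)..1, iteratedDeriv k ω x * legendreKernel n (k - 1 : ℕ) x := by
  have hk1 : (1 : ℝ) ≤ k := by exact_mod_cast hk
  have hθ : 0 < (k : ℝ) - α := by linarith
  have h := integral_riemannLiouville_mul_legendreKernel n hα hθ (by linarith) hω
  simp only [caputoL, mul_assoc, intervalIntegral.integral_const_mul]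
  rw [h, Nat.cast_sub hk, Nat.cast_one, show α + (k - α) - 1 = (k : ℝ) - 1 by ring, ← mul_assoc,
    one_div_mul_cancel (Real.Gamma_pos_of_pos hθ).ne', one_mul]

theorem integral_iteratedDeriv_one_mul_legendreKernel {k n : ℕ} (hkn : k ≤ n + 1) {ω : ℝ → ℝ}
    (hd : ∀ i < k, ∀ x ∈ Ioo (-1 : ℝ) 1,
      HasDerivAt (iteratedDeriv i ω) (iteratedDeriv (i + 1) ω x) x)
    (hi : ∀ i ≤ k, IntervalIntegrable (iteratedDeriv i ω) volume (-1) 1) {i : ℕ} (hik : i < k) :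
    ∫ x in (-1 : ℝ)..1, iteratedDeriv 1 ω x * legendreKernel n 0 x
      = ∫ x in (-1 : ℝ)..1, iteratedDeriv (i + 1) ω x * legendreKernel n i x := by
  induction i with
  | zero => simp
  | succ i ih =>
    rw [ih (by lia), integral_mul_legendreKernel_natCast (hd (i + 1) hik) (hi (i + 2) (by lia))
      (by lia)]

theorem integral_mul_legendreKernel_eq_sum {m : ℕ} {g : ℝ → ℝ} {L : ℕ → ℝ}
    (hd : ∀ i < m, ∀ x ∈ Ioo (-1 : ℝ) 1,
      HasDerivAt (iteratedDeriv i g) (iteratedDeriv (i + 1) g x) x)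
    (hi : ∀ i ≤ m, IntervalIntegrable (iteratedDeriv i g) volume (-1) 1)
    (hL : ∀ i < m, Tendsto (iteratedDeriv i g) (nhdsWithin (-1) (Ioi (-1))) (nhds (L i)))
    (n : ℕ) {α : ℝ} (hα : 0 < α) {j : ℕ} (hj : j ≤ m) :
    ∫ x in (-1 : ℝ)..1, g x * legendreKernel n (α - 1) x
      = ∑ i ∈ Finset.range j, L i * legendreKernel n (α + i) (-1)
        + ∫ x in (-1 : ℝ)..1, iteratedDeriv j g x * legendreKernel n (α + j - 1) x := by
  induction j with
  | zero => simp
  | succ j ih =>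
    rw [ih (by lia), integral_mul_legendreKernel_of_tendsto (hd j (by lia)) (hi (j + 1) hj)
      (hL j (by lia)) n (by linarith [j.cast_nonneg (α := ℝ)] : -1 < α + j - 1),
      Finset.sum_range_succ, sub_add_cancel, Nat.cast_succ,
      show α + (j + 1) - 1 = α + (j : ℝ) by ring, add_assoc]

theorem exists_abs_integral_iteratedDeriv_one_mul_legendreKernel_le {k m : ℕ} (hk : 1 ≤ k)
    (hm : 1 ≤ m) {α : ℝ} (hα1 : (k : ℝ) - 1 < α) (hα2 : α < k) :
    ∃ C > (0 : ℝ), ∀ p : ℕ, α + (m : ℝ) < (p : ℝ) + 1 → ∀ (ω : ℝ → ℝ) (L : ℕ → ℝ),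
      MemUL k m α ω L →
        |∫ x in (-1 : ℝ)..1, iteratedDeriv 1 ω x * legendreKernel p 0 x| ≤
          C * (p : ℝ) ^ (-(min (2 * α) (α + (m : ℝ) - 1 / 2))) * UsemiL k m α ω L := by
  have h11 : (-1 : ℝ) ≤ 1 := by norm_num
  have hk1 : (1 : ℝ) ≤ k := by exact_mod_cast hk
  have hm1 : (1 : ℝ) ≤ m := by exact_mod_cast hm
  have hα : 0 < α := by linarith
  obtain ⟨e, he⟩ : ∃ e, e = min (2 * α) (α + (m : ℝ) - 1 / 2) := ⟨_, rfl⟩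
  rw [← he]
  have he0 : 0 ≤ e := he ▸ le_min (by linarith) (by linarith)
  obtain ⟨A, hA0, hA⟩ := exists_abs_legendreInt_le_rpow (by linarith : 0 < α + m - 1)
  have hα_add : ∀ i : ℕ, 0 < α + i := fun i => by positivity
  choose c hc0 hc using fun i : ℕ => exists_abs_legendreInt_one_le (hα_add i)
  obtain ⟨S, hS⟩ : ∃ S, S = ∑ i ∈ Finset.range m, 2 ^ (α + i) * c i := ⟨_, rfl⟩
  have hterm : ∀ i : ℕ, 0 ≤ 2 ^ (α + i) * c i := fun i => mul_nonneg (by positivity) (hc0 i)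
  have hS0 : 0 ≤ S := hS ▸ Finset.sum_nonneg fun i _ => hterm i
  have hA' : 0 ≤ 2 ^ (α + m - 1) * A := by positivity
  refine ⟨2 ^ (α + m - 1) * A + S + 1, by positivity, fun p hp ω L h => ?_⟩
  obtain ⟨-, hωd, hωi, hgd, hgi, hL⟩ := h
  have hp0 : (0 : ℝ) < p := by linarith
  have hpow : ∀ s, e ≤ s → ((p : ℝ) + 1) ^ (-s) ≤ (p : ℝ) ^ (-e) := fun s hs =>
    (Real.rpow_le_rpow_of_exponent_le (by linarith) (by linarith)).trans
      (Real.rpow_le_rpow_of_nonpos hp0 (by linarith) (by linarith))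
  obtain ⟨q, hq⟩ : ∃ q, q = (p : ℝ) ^ (-e) := ⟨_, rfl⟩
  rw [← hq] at hpow ⊢
  have hq0 : 0 ≤ q := hq ▸ by positivity
  have hkp : k ≤ p + 1 := by exact_mod_cast (by linarith : (k : ℝ) ≤ p + 1)
  obtain ⟨k', rfl⟩ : ∃ k', k = k' + 1 := ⟨k - 1, by lia⟩
  have hcap := integral_caputoL_mul_legendreKernel hk hα hα2 (hωi _ le_rfl) p
  rw [Nat.add_sub_cancel] at hcap
  rw [integral_iteratedDeriv_one_mul_legendreKernel hkp hωd hωi (Nat.lt_succ_self k'), ← hcap,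
    integral_mul_legendreKernel_eq_sum hgd hgi hL p hα le_rfl]
  have hsum : |∑ i ∈ Finset.range m, L i * legendreKernel p (α + i) (-1)|
      ≤ S * q * ∑ i ∈ Finset.range m, |L i| := by
    refine (Finset.abs_sum_le_sum_abs _ _).trans ?_
    rw [Finset.mul_sum]
    refine Finset.sum_le_sum fun i hi => ?_
    rw [abs_mul, mul_comm]
    refine mul_le_mul_of_nonneg_right ?_ (abs_nonneg _)
    have h1 : 2 ^ (α + i) * c i ≤ S :=
      hS ▸ Finset.single_le_sum (f := fun i : ℕ => 2 ^ (α + i) * c i) (fun i _ => hterm i) hi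
    have h2 : e ≤ 2 * (α + i) :=
      (he ▸ min_le_left _ _ : e ≤ 2 * α).trans (by linarith [i.cast_nonneg (α := ℝ)])
    rw [legendreKernel_neg_one, abs_mul, abs_of_pos (by positivity : (0 : ℝ) < 2 ^ (α + (i : ℝ)))]
    calc (2 : ℝ) ^ (α + (i : ℝ)) * |legendreInt p (α + i) 1|
        ≤ 2 ^ (α + (i : ℝ)) * (c i * q) := mul_le_mul_of_nonneg_left
          ((hc i p).trans (mul_le_mul_of_nonneg_left (hpow _ h2) (hc0 i))) (by positivity)
      _ = 2 ^ (α + (i : ℝ)) * c i * q := by ring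
      _ ≤ S * q := mul_le_mul_of_nonneg_right h1 hq0
  have hker : ∀ x ∈ Ioc (-1 : ℝ) 1,
      |legendreKernel p (α + m - 1) x| ≤ 2 ^ (α + m - 1) * A * q := by
    intro x hx
    have h1 : e ≤ min (2 * (α + m - 1)) (α + m - 1 + 1 / 2) := by
      rw [he]
      exact min_le_min (by linarith) (by linarith)
    rw [legendreKernel, abs_mul, abs_of_pos (by positivity : (0 : ℝ) < 2 ^ (α + (m : ℝ) - 1)),
      mul_assoc]
    exact mul_le_mul_of_nonneg_left
      ((hA p (by linarith) _ (by linarith [hx.2]) (by linarith [hx.1])).trans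
        (mul_le_mul_of_nonneg_left (hpow _ h1) hA0)) (by positivity)
  obtain ⟨g, hg⟩ : ∃ g, g = iteratedDeriv m (caputoL (k' + 1) α (-1) ω) := ⟨_, rfl⟩
  have hgm := hgi m le_rfl
  rw [UsemiL, ← hg]
  rw [← hg] at hgm
  have hInt : |∫ x in (-1 : ℝ)..1, g x * legendreKernel p (α + m - 1) x|
      ≤ 2 ^ (α + m - 1) * A * q * ∫ x in (-1 : ℝ)..1, |g x| := by
    rw [← intervalIntegral.integral_const_mul, ← Real.norm_eq_abs]
    refine intervalIntegral.norm_integral_le_of_norm_le h11 (ae_of_all _ fun x hx => ?_)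
      (hgm.abs.const_mul _)
    rw [Real.norm_eq_abs, abs_mul, mul_comm]
    exact mul_le_mul_of_nonneg_right (hker x hx) (abs_nonneg _)
  have hI : 0 ≤ ∫ x in (-1 : ℝ)..1, |g x| :=
    intervalIntegral.integral_nonneg h11 fun x _ => abs_nonneg _
  have hLs : 0 ≤ ∑ i ∈ Finset.range m, |L i| := Finset.sum_nonneg fun i _ => abs_nonneg _
  refine (abs_add_le _ _).trans ((add_le_add hsum hInt).trans ?_)
  nlinarith [mul_nonneg (mul_nonneg hS0 hq0) hI, mul_nonneg (mul_nonneg hA' hq0) hLs,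
    mul_nonneg hq0 hI, mul_nonneg hq0 hLs]

/-- endpoint estimates for the Gauss–Radau projections `Π_p^±`
of `ω ∈ 𝒰^{α,m}_{−1+}((−1,1))`. -/
theorem stmt_10 (k m : ℕ) (hk : 1 ≤ k) (hm : 1 ≤ m) (α : ℝ)
    (hα1 : (k : ℝ) - 1 < α) (hα2 : α < (k : ℝ)) (hαint : ∀ j : ℤ, α ≠ (j : ℝ))
    (hαm : 1 / 2 < α + (m : ℝ)) :
    ∃ C > (0 : ℝ), ∀ p : ℕ, α + (m : ℝ) < (p : ℝ) + 1 →
      ∀ (ω : ℝ → ℝ) (L : ℕ → ℝ), MemUL k m α ω L →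
        (∀ P : Polynomial ℝ, P.natDegree ≤ p →
          (∀ v : Polynomial ℝ, v.natDegree < p →
              ∫ x in (-1 : ℝ)..1, (P.eval x - ω x) * v.eval x = 0) →
          P.eval 1 = ω 1 →
          |ω (-1) - P.eval (-1)| ≤
            C * (p : ℝ) ^ (-(min (2 * α) (α + (m : ℝ) - 1 / 2))) *
              UsemiL k m α ω L) ∧
        (∀ P : Polynomial ℝ, P.natDegree ≤ p →
          (∀ v : Polynomial ℝ, v.natDegree < p →
              ∫ x in (-1 : ℝ)..1, (P.eval x - ω x) * v.eval x = 0) →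
          P.eval (-1) = ω (-1) →
          |ω 1 - P.eval 1| ≤
            C * (p : ℝ) ^ (-(min (2 * α) (α + (m : ℝ) - 1 / 2))) *
              UsemiL k m α ω L) := by
  obtain ⟨C, hC0, hC⟩ := exists_abs_integral_iteratedDeriv_one_mul_legendreKernel_le hk hm hα1 hα2
  refine ⟨C, hC0, fun p hp ω L h => ?_⟩
  have hk1 : (1 : ℝ) ≤ k := by exact_mod_cast hk
  have hm1 : (1 : ℝ) ≤ m := by exact_mod_cast hm
  have hp1 : 1 ≤ p := Nat.one_le_iff_ne_zero.2 fun h0 => by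
    rw [h0, Nat.cast_zero] at hp
    linarith
  have hbound := hC p hp ω L h
  have hd : ∀ x ∈ Ioo (-1 : ℝ) 1, HasDerivAt ω (iteratedDeriv 1 ω x) x := by
    simpa using h.2.1 0 hk
  have hi := h.2.2.1 1 hk
  refine ⟨fun P hP hort hend => ?_, fun P hP hort hend => ?_⟩
  · rw [integral_deriv_mul_legendreKernel_zero hp1 h.1 hd hi hP hort, hend, sub_self, zero_mul,
      zero_sub, abs_neg, abs_mul, abs_legendreKernel_zero_neg_one, mul_one] at hbound
    exact hbound
  · rw [integral_deriv_mul_legendreKernel_zero hp1 h.1 hd hi hP hort, hend, sub_self, zero_mul,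
      sub_zero, abs_mul, abs_legendreKernel_zero_one, mul_one] at hbound
    exact hbound
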